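/- arXiv:1112.5737 — 3 statements merged into one kernel-verified Lean document; each statement's English description precedes it below -/
import Mathlib

section
/- Let d ≥ 1 and k ≥ 1 be integers, let α > 0, and suppose m is a positive integer such that every nice measure μ on ℝ^d admits a family of m closed convex subsets of ℝ^d, each of μ-measure at least α, such that every hyperplane avoids at least k of them. Then (α/2, k/(2m)) ∈ C_d. -/
open MeasureTheory Set Metric
open scoped ENNReal
noncomputable section

abbrev Euc (d : ℕ) := EuclideanSpace ℝ (Fin d)

/-- A nice measure on ℝ^d: a probability measure with a continuous,
strictly positive density with respect to Lebesgue measure. -/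
def NiceMeasure (d : ℕ) (μ : Measure (Euc d)) : Prop :=
  IsProbabilityMeasure μ ∧ ∃ f : Euc d → ℝ, Continuous f ∧ (∀ x, 0 < f x) ∧
    μ = volume.withDensity (fun x => ENNReal.ofReal (f x))

/-- The affine hyperplane with normal vector `v` and offset `c`. -/
def Hyperplane {d : ℕ} (v : Euc d) (c : ℝ) : Set (Euc d) := {x | inner (𝕜 := ℝ) v x = c}

/-- A set `H` avoids a set `C` if `H` is disjoint from the interior of `C`. -/
def Avoids {d : ℕ} (H C : Set (Euc d)) : Prop := H ∩ interior C = ∅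

/-- A convex partition of ℝ^d into `n` parts: `n` closed convex sets with pairwise
disjoint interiors whose union is all of ℝ^d. -/
def IsConvexPartition {d n : ℕ} (C : Fin n → Set (Euc d)) : Prop :=
  (∀ i, IsClosed (C i)) ∧ (∀ i, Convex ℝ (C i)) ∧
  (∀ i j, i ≠ j → interior (C i) ∩ interior (C j) = ∅) ∧ (⋃ i, C i) = univ

/-- A `k`-equipartition of `μ` into `n` parts: a convex partition into `n` parts,
each of measure `1/n`, such that every hyperplane avoids at least `k` parts. -/
def IsEquipartition {d n : ℕ} (μ : Measure (Euc d)) (k : ℕ) (C : Fin n → Set (Euc d)) : Prop :=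
  IsConvexPartition C ∧ (∀ i, μ (C i) = (n : ℝ≥0∞)⁻¹) ∧
  ∀ v : Euc d, ∀ c : ℝ, v ≠ 0 → k ≤ {i | Avoids (Hyperplane v c) (C i)}.ncard

/-- Every nice measure on ℝ^d admits a `k`-equipartition into `n` parts. -/
def HasEquipartition (d k n : ℕ) : Prop :=
  ∀ μ : Measure (Euc d), NiceMeasure d μ → ∃ C : Fin n → Set (Euc d), IsEquipartition μ k C

/-- `N_d(k)`: the smallest positive `n` such that every nice measure on ℝ^d admits a
`k`-equipartition into `n` parts. -/
def Nd (d k : ℕ) : ℕ := sInf {n | 0 < n ∧ HasEquipartition d k n}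
abbrev Sph (d : ℕ) := Metric.sphere (0 : EuclideanSpace ℝ (Fin (d + 1))) 1

/-- `σ_d`: the rotation-invariant (uniform) probability measure on the sphere `S^d`,
obtained by normalizing the surface measure induced by Lebesgue measure. -/
def sphMeasure (d : ℕ) : Measure (Sph d) :=
  ((volume : Measure (EuclideanSpace ℝ (Fin (d + 1)))).toSphere Set.univ)⁻¹ •
    (volume : Measure (EuclideanSpace ℝ (Fin (d + 1)))).toSphere

/-- `h_d(t)`: the `σ_d`-measure of a spherical cap of `S^d` with central angle `t`. -/
def capMeasure (d : ℕ) (t : ℝ) : ℝ≥0∞ :=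
  sphMeasure d {x : Sph d |
    Real.cos t ≤ inner (𝕜 := ℝ) (x : EuclideanSpace ℝ (Fin (d + 1))) (EuclideanSpace.single 0 1)}

/-- A nice measure on `S^d`: a probability measure with a continuous strictly positive
density with respect to `σ_d`. -/
def NiceSphMeasure (d : ℕ) (μ : Measure (Sph d)) : Prop :=
  IsProbabilityMeasure μ ∧ ∃ f : Sph d → ℝ, Continuous f ∧ (∀ x, 0 < f x) ∧
    μ = (sphMeasure d).withDensity (fun x => ENNReal.ofReal (f x))

/-- The set `C_d` of pairs `(α, β)` such that for any two nice measures `μ1, μ2` on `S^d`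
there are sets `A, B` with `μ1 A ≥ α`, `μ2 B ≥ β` on which the inner product has constant sign. -/
def CSet (d : ℕ) : Set (ℝ × ℝ) :=
  {p | 0 ≤ p.1 ∧ 0 ≤ p.2 ∧
    ∀ μ1 μ2 : Measure (Sph d), NiceSphMeasure d μ1 → NiceSphMeasure d μ2 →
      ∃ A B : Set (Sph d), ENNReal.ofReal p.1 ≤ μ1 A ∧ ENNReal.ofReal p.2 ≤ μ2 B ∧
        ((∀ a ∈ A, ∀ b ∈ B, 0 ≤ inner (𝕜 := ℝ) (a : EuclideanSpace ℝ (Fin (d + 1)))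
            (b : EuclideanSpace ℝ (Fin (d + 1)))) ∨
         (∀ a ∈ A, ∀ b ∈ B, inner (𝕜 := ℝ) (a : EuclideanSpace ℝ (Fin (d + 1)))
            (b : EuclideanSpace ℝ (Fin (d + 1))) ≤ 0))}

/-- Every nice measure on ℝ^d admits a family of m closed convex sets, each of measure at
least α, such that every hyperplane avoids at least k of them. -/
def HasConvexFamily (d k m : ℕ) (α : ℝ) : Prop :=
  ∀ μ : Measure (Euc d), NiceMeasure d μ →
    ∃ F : Fin m → Set (Euc d), (∀ i, IsClosed (F i)) ∧ (∀ i, Convex ℝ (F i)) ∧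
      (∀ i, ENNReal.ofReal α ≤ μ (F i)) ∧
      (∀ v : Euc d, ∀ c : ℝ, v ≠ 0 → k ≤ {i | Avoids (Hyperplane v c) (F i)}.ncard)



open scoped Pointwise

/-- The last `d` coordinates. -/
def tailE {d : ℕ} (w : Euc (d + 1)) : Euc d := WithLp.toLp 2 (fun i => w i.succ)

/-- The lift of a point of `ℝ^d` to height one. -/
def liftE {d : ℕ} (y : Euc d) : Euc (d + 1) := WithLp.toLp 2 (Fin.cons 1 (fun i => y i))

/-- Central projection. -/
def projE {d : ℕ} (w : Euc (d + 1)) : Euc d := (w 0)⁻¹ • tailE w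

lemma liftE_zero {d : ℕ} (y : Euc d) : liftE y 0 = 1 := rfl

lemma tailE_liftE {d : ℕ} (y : Euc d) : tailE (liftE y) = y := by
  ext i; simp [tailE, liftE]

lemma inner_split {d : ℕ} (a b : Euc (d + 1)) :
    inner ℝ a b = a 0 * b 0 + inner ℝ (tailE a) (tailE b) := by
  simp [PiLp.inner_apply, Fin.sum_univ_succ, tailE, mul_comm]

lemma norm_sq_split {d : ℕ} (a : Euc (d + 1)) :
    ‖a‖ ^ 2 = (a 0) ^ 2 + ‖tailE a‖ ^ 2 := by
  rw [← real_inner_self_eq_norm_sq, inner_split, real_inner_self_eq_norm_sq]; ring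

lemma tailE_smul {d : ℕ} (t : ℝ) (a : Euc (d + 1)) : tailE (t • a) = t • tailE a := by
  ext i; simp [tailE]

lemma ext_split {d : ℕ} {a b : Euc (d + 1)} (h0 : a 0 = b 0) (h : tailE a = tailE b) : a = b := by
  ext i
  refine Fin.cases h0 (fun j => ?_) i
  have := congrArg (fun z : Euc d => z j) h
  simpa [tailE] using this

lemma continuous_tailE {d : ℕ} : Continuous (tailE : Euc (d + 1) → Euc d) := by
  unfold tailE; fun_prop

lemma continuous_liftE {d : ℕ} : Continuous (liftE : Euc d → Euc (d + 1)) := by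
  unfold liftE
  refine (PiLp.continuous_toLp 2 _).comp (continuous_pi fun i => ?_)
  refine Fin.cases ?_ (fun j => ?_) i
  · simpa using continuous_const
  · simp only [Fin.cons_succ]; fun_prop

lemma measurable_projE {d : ℕ} : Measurable (projE : Euc (d + 1) → Euc d) := by
  unfold projE
  have h1 : Measurable (fun w : Euc (d + 1) => w 0) := by
    exact Continuous.measurable (by fun_prop)
  exact h1.inv.smul continuous_tailE.measurable

lemma projE_smul {d : ℕ} {t : ℝ} (ht : t ≠ 0) (a : Euc (d + 1)) : projE (t • a) = projE a := by
  simp only [projE, tailE_smul, PiLp.smul_apply, smul_eq_mul, smul_smul]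
  congr 1
  field_simp

lemma projE_neg {d : ℕ} (a : Euc (d + 1)) : projE (-a) = projE a := by
  have := projE_smul (t := -1) (by norm_num) a
  simpa using this

lemma liftE_projE {d : ℕ} {a : Euc (d + 1)} (h : a 0 ≠ 0) : liftE (projE a) = (a 0)⁻¹ • a := by
  apply ext_split
  · simp [liftE_zero, h]
  · rw [tailE_liftE, tailE_smul]; rfl

lemma liftE_ne {d : ℕ} (y : Euc d) : liftE y ≠ 0 := by
  intro h
  have := congrArg (fun z : Euc (d+1) => z 0) h
  simp [liftE_zero] at this

/-- The splitting of coordinates preserves volume. -/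
lemma mp_split (d : ℕ) : MeasurePreserving (fun w : Euc (d + 1) => (w 0, tailE w))
    volume (volume.prod volume) := by
  have h1 := PiLp.volume_preserving_ofLp (Fin (d + 1))
  have h2 := volume_preserving_piFinSuccAbove (fun _ : Fin (d + 1) => ℝ) 0
  have h3 := PiLp.volume_preserving_toLp (Fin d)
  have h4 : MeasurePreserving (Prod.map id (@WithLp.toLp 2 (Fin d → ℝ)))
    ((volume : Measure ℝ).prod (volume : Measure (Fin d → ℝ)))
    ((volume : Measure ℝ).prod (volume : Measure (Euc d))) := (MeasurePreserving.id _).prod h3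
  exact (h4.comp (h2.comp h1))

lemma lint_pow (d : ℕ) {r : ℝ} (hr : 0 < r) :
    ∫⁻ t in Ioo 0 r, ENNReal.ofReal (t ^ d) = ENNReal.ofReal (r ^ (d + 1) / (d + 1)) := by
  rw [← ofReal_integral_eq_lintegral_ofReal]
  · rw [← integral_Ioc_eq_integral_Ioo, ← intervalIntegral.integral_of_le hr.le, integral_pow]
    simp
  · exact (((continuous_pow d).integrableOn_Icc (a := 0) (b := r))).mono_set Ioo_subset_Icc_self
  · refine (ae_restrict_iff' measurableSet_Ioo).2 (Filter.Eventually.of_forall fun t ht => ?_)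
    exact pow_nonneg ht.1.le _

/-- The volume of the truncated cone over `C`. -/
lemma cone_volume (d : ℕ) {C : Set (Euc d)} (hC : MeasurableSet C) :
    (volume : Measure (Euc (d + 1))) {w | 0 < w 0 ∧ projE w ∈ C ∧ ‖w‖ < 1} =
      ∫⁻ y in C, ENNReal.ofReal (((‖liftE y‖)⁻¹) ^ (d + 1) / (d + 1)) := by
  set S : Set (ℝ × Euc d) := {p | 0 < p.1 ∧ p.1⁻¹ • p.2 ∈ C ∧ p.1 ^ 2 + ‖p.2‖ ^ 2 < 1} with hS
  have hSm : MeasurableSet S := by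
    refine (measurableSet_lt measurable_const measurable_fst).inter (MeasurableSet.inter ?_ ?_)
    · exact (measurable_fst.inv.smul measurable_snd) hC
    · exact measurableSet_lt ((measurable_fst.pow_const 2).add (measurable_snd.norm.pow_const 2))
        measurable_const
  have e1 : {w : Euc (d + 1) | 0 < w 0 ∧ projE w ∈ C ∧ ‖w‖ < 1} =
      (fun w : Euc (d + 1) => (w 0, tailE w)) ⁻¹' S := by
    ext w
    simp only [hS, mem_ofPred_eq, mem_preimage, ← norm_sq_split, projE]
    rw [sq_lt_one_iff₀ (norm_nonneg w)]
  rw [e1, (mp_split d).measure_preimage hSm.nullMeasurableSet, Measure.prod_apply hSm]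
  set T : Set (ℝ × Euc d) := {p | 0 < p.1 ∧ p.2 ∈ C ∧ p.1 < (‖liftE p.2‖)⁻¹} with hT
  have hTm : MeasurableSet T := by
    refine (measurableSet_lt measurable_const measurable_fst).inter (MeasurableSet.inter ?_ ?_)
    · exact measurable_snd hC
    · refine measurableSet_lt measurable_fst ?_
      exact ((continuous_liftE.measurable.comp measurable_snd).norm).inv
  have e2 : ∀ t : ℝ, volume (Prod.mk t ⁻¹' S) =
      ∫⁻ y, T.indicator (fun p : ℝ × Euc d => ENNReal.ofReal (p.1 ^ d)) (t, y) := by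
    intro t
    rcases le_or_gt t 0 with ht | ht
    · have : Prod.mk t ⁻¹' S = ∅ := by
        ext z; simp [hS, not_lt.2 ht]
      rw [this]
      simp [hT, indicator, not_lt.2 ht]
    · have : Prod.mk t ⁻¹' S = t • (Prod.mk t ⁻¹' T) := by
        ext z
        rw [mem_smul_set_iff_inv_smul_mem₀ ht.ne']
        simp only [hS, hT, mem_preimage, mem_ofPred_eq, ht, true_and]
        refine and_congr_right fun _ => ?_
        have hp : 0 < ‖liftE (t⁻¹ • z)‖ := norm_pos_iff.2 (liftE_ne _)
        rw [lt_inv_comm₀ ht hp, ← sq_lt_sq₀ hp.le (by positivity), norm_sq_split, tailE_liftE,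
          liftE_zero, norm_smul, mul_pow, norm_inv, Real.norm_of_nonneg ht.le, inv_pow,
          ← mul_lt_mul_iff_right₀ (show 0 < t ^ 2 by positivity)]
        field_simp
      rw [this, Measure.addHaar_smul]
      have e3 : (fun y => T.indicator (fun p : ℝ × Euc d => ENNReal.ofReal (p.1 ^ d)) (t, y)) =
          (Prod.mk t ⁻¹' T).indicator (fun _ => ENNReal.ofReal (t ^ d)) := by
        ext y; rfl
      rw [e3, lintegral_indicator_const (measurable_prodMk_left hTm)]
      simp [abs_of_pos ht]
  simp_rw [e2]
  rw [lintegral_lintegral_swap, ← lintegral_indicator hC]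
  · refine lintegral_congr fun y => ?_
    by_cases hy : y ∈ C
    · rw [indicator_of_mem hy, ← lint_pow d (inv_pos.2 (norm_pos_iff.2 (liftE_ne y))),
        ← lintegral_indicator measurableSet_Ioo]
      refine lintegral_congr fun t => ?_
      simp [hT, indicator, hy]
    · simp [hT, indicator, hy]
  · refine Measurable.aemeasurable ?_
    exact Measurable.indicator (by fun_prop) hTm

lemma cone_set {d : ℕ} (C : Set (Euc d)) :
    Ioo (0 : ℝ) 1 • ((fun x : Sph d => (x : Euc (d + 1))) '' {x : Sph d | 0 < (x : Euc (d + 1)) 0 ∧ projE (x : Euc (d + 1)) ∈ C}) =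
    {w : Euc (d + 1) | 0 < w 0 ∧ projE w ∈ C ∧ ‖w‖ < 1} := by
  ext w
  constructor
  · rintro ⟨t, ht, _, ⟨x, hx, rfl⟩, rfl⟩
    have hn : ‖(x : Euc (d + 1))‖ = 1 := by simpa using x.2
    refine ⟨?_, ?_, ?_⟩
    · simpa using mul_pos ht.1 hx.1
    · simpa only [projE_smul ht.1.ne'] using hx.2
    · simp only [norm_smul, hn, Real.norm_of_nonneg ht.1.le, mul_one]; exact ht.2
  · rintro ⟨h0, h1, h2⟩
    have hw : w ≠ 0 := by rintro rfl; simp at h0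
    have hp := norm_pos_iff.2 hw
    refine ⟨‖w‖, ⟨hp, h2⟩, ‖w‖⁻¹ • w, ⟨⟨‖w‖⁻¹ • w, ?_⟩, ⟨?_, ?_⟩, rfl⟩, ?_⟩
    · simp [norm_smul, hp.ne']
    · simpa using mul_pos (inv_pos.2 hp) h0
    · simpa only [projE_smul (inv_pos.2 hp).ne'] using h1
    · simp [smul_smul, hp.ne']

lemma norm_sph {d : ℕ} (x : Sph d) : ‖(x : Euc (d + 1))‖ = 1 := by simp

/-- Open upper half sphere. -/
def posS (d : ℕ) : Set (Sph d) := {x | 0 < (x : Euc (d + 1)) 0}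

/-- Central projection on the sphere. -/
def pr {d : ℕ} (x : Sph d) : Euc d := projE (x : Euc (d + 1))

lemma measurable_pr {d : ℕ} : Measurable (pr : Sph d → Euc d) :=
  measurable_projE.comp measurable_subtype_coe

lemma continuous_coord0 {d : ℕ} : Continuous (fun x : Sph d => (x : Euc (d + 1)) 0) := by
  fun_prop

lemma measurableSet_posS (d : ℕ) : MeasurableSet (posS d) :=
  measurableSet_lt measurable_const continuous_coord0.measurable

/-- Inverse of the central projection. -/
def upS {d : ℕ} (y : Euc d) : Sph d :=
  ⟨‖liftE y‖⁻¹ • liftE y, by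
    have := (norm_pos_iff.2 (liftE_ne y)).ne'
    simp [norm_smul, this]⟩

lemma continuous_upS {d : ℕ} : Continuous (upS : Euc d → Sph d) := by
  refine Continuous.subtype_mk ?_ _
  exact (continuous_liftE.norm.inv₀ fun y => (norm_pos_iff.2 (liftE_ne y)).ne').smul continuous_liftE

lemma upS_pr {d : ℕ} {x : Sph d} (hx : x ∈ posS d) : upS (pr x) = x := by
  have hx : 0 < (x : Euc (d + 1)) 0 := hx
  apply Subtype.ext
  simp only [upS, pr, liftE_projE hx.ne', norm_smul, norm_sph, norm_inv, Real.norm_of_nonneg hx.le,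
    smul_smul]
  field_simp
  simp

/-- normalising constant -/
def cS (d : ℕ) : ℝ≥0∞ := ((volume : Measure (Euc (d + 1))).toSphere Set.univ)⁻¹

lemma cS_ne_top (d : ℕ) : cS d ≠ ∞ := by
  unfold cS
  rw [ENNReal.inv_ne_top, Measure.measure_univ_ne_zero]
  exact Measure.toSphere_ne_zero _

lemma cS_ne_zero (d : ℕ) : cS d ≠ 0 := by
  unfold cS
  rw [ENNReal.inv_ne_zero]
  exact measure_ne_top _ _

/-- density of the projected uniform measure -/
def dens {d : ℕ} (y : Euc d) : ℝ := (cS d).toReal * (‖liftE y‖⁻¹) ^ (d + 1)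

lemma dens_pos {d : ℕ} (y : Euc d) : 0 < dens y := by
  have := (norm_pos_iff.2 (liftE_ne y))
  have := ENNReal.toReal_pos (cS_ne_zero d) (cS_ne_top d)
  unfold dens
  positivity

lemma continuous_dens {d : ℕ} : Continuous (dens : Euc d → ℝ) :=
  continuous_const.mul
    ((continuous_liftE.norm.inv₀ fun y => (norm_pos_iff.2 (liftE_ne y)).ne').pow _)

lemma map_pr_unif (d : ℕ) : ((sphMeasure d).restrict (posS d)).map pr =
    (volume : Measure (Euc d)).withDensity (fun y => ENNReal.ofReal (dens y)) := by
  ext C hC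
  rw [Measure.map_apply measurable_pr hC, Measure.restrict_apply (measurable_pr hC),
    withDensity_apply _ hC]
  have e : pr ⁻¹' C ∩ posS d =
      {x : Sph d | 0 < (x : Euc (d + 1)) 0 ∧ projE (x : Euc (d + 1)) ∈ C} := by
    ext x; exact and_comm
  have hm : MeasurableSet (pr ⁻¹' C ∩ posS d) := (measurable_pr hC).inter (measurableSet_posS d)
  rw [sphMeasure, Measure.smul_apply, Measure.toSphere_apply' _ hm, e, cone_set, cone_volume d hC,
    smul_eq_mul, ← lintegral_const_mul', ← lintegral_const_mul']
  · refine lintegral_congr fun y => ?_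
    have h1 : ((volume : Measure (Euc (d + 1))).toSphere Set.univ)⁻¹ =
        ENNReal.ofReal (cS d).toReal := (ENNReal.ofReal_toReal (cS_ne_top d)).symm
    rw [h1, ← ENNReal.ofReal_natCast, ← ENNReal.ofReal_mul (by positivity),
      ← ENNReal.ofReal_mul ENNReal.toReal_nonneg, dens]
    congr 2
    simp only [finrank_euclideanSpace, Fintype.card_fin]
    push_cast
    field_simp
  · exact cS_ne_top d
  · exact ENNReal.natCast_ne_top _

lemma map_pr_pos (d : ℕ) {F : Sph d → ℝ≥0∞} (hF : Measurable F) :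
    (((sphMeasure d).withDensity F).restrict (posS d)).map pr =
    (volume : Measure (Euc d)).withDensity (fun y => ENNReal.ofReal (dens y) * F (upS y)) := by
  ext C hC
  have hG : Measurable (fun y : Euc d => F (upS y)) := hF.comp continuous_upS.measurable
  have hD : Measurable (fun y : Euc d => ENNReal.ofReal (dens y)) :=
    continuous_dens.measurable.ennreal_ofReal
  rw [Measure.map_apply measurable_pr hC, Measure.restrict_apply (measurable_pr hC),
    withDensity_apply _ hC, withDensity_apply _ ((measurable_pr hC).inter (measurableSet_posS d))]
  have h1 : ∫⁻ x in pr ⁻¹' C ∩ posS d, F x ∂(sphMeasure d) =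
      ∫⁻ x in pr ⁻¹' C ∩ posS d, F (upS (pr x)) ∂(sphMeasure d) := by
    refine setLIntegral_congr_fun ((measurable_pr hC).inter (measurableSet_posS d)) ?_
    intro x hx
    simp only [upS_pr hx.2]
  rw [h1, ← Measure.restrict_restrict (measurable_pr hC),
    ← setLIntegral_map hC hG measurable_pr, map_pr_unif,
    setLIntegral_withDensity_eq_setLIntegral_mul _ hD hG hC]
  rfl

lemma sph_map_neg (d : ℕ) : (sphMeasure d).map (fun x => -x) = sphMeasure d := by
  ext s hs
  have hn : Measurable (fun x : Sph d => -x) := continuous_neg.measurable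
  rw [Measure.map_apply hn hs, sphMeasure, Measure.smul_apply, Measure.smul_apply,
    Measure.toSphere_apply' _ hs, Measure.toSphere_apply' _ (hn hs)]
  congr 2
  rw [← Measure.measure_neg]
  congr 1
  ext w
  constructor
  · rintro ⟨t, ht, _, ⟨x, hx, rfl⟩, h⟩
    refine ⟨t, ht, _, ⟨-x, hx, rfl⟩, ?_⟩
    have : w = - (t • (x : Euc (d + 1))) := by rw [eq_comm, neg_eq_iff_eq_neg]; exact h
    simp [this]
  · rintro ⟨t, ht, _, ⟨x, hx, rfl⟩, rfl⟩
    refine ⟨t, ht, _, ⟨-x, ?_, rfl⟩, ?_⟩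
    · simpa using hx
    · simp

lemma equator_null (d : ℕ) : sphMeasure d {x | (x : Euc (d + 1)) 0 = 0} = 0 := by
  have hm : MeasurableSet {x : Sph d | (x : Euc (d + 1)) 0 = 0} :=
    continuous_coord0.measurable (measurableSet_singleton 0)
  rw [sphMeasure, Measure.smul_apply, Measure.toSphere_apply' _ hm]
  let K : Submodule ℝ (Euc (d + 1)) :=
    { carrier := {w | w 0 = 0}
      add_mem' := by
        intro a b (ha : a 0 = 0) (hb : b 0 = 0)
        change (a + b) 0 = 0
        simp [ha, hb]
      zero_mem' := by
        change (0 : Euc (d + 1)) 0 = 0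
        simp
      smul_mem' := by
        intro c a (ha : a 0 = 0)
        change (c • a) 0 = 0
        simp [ha] }
  have hK : (volume : Measure (Euc (d + 1))) K = 0 := by
    apply Measure.addHaar_submodule
    intro h
    have : liftE (0 : Euc d) ∈ K := by rw [h]; trivial
    have : liftE (0 : Euc d) 0 = 0 := this
    simp [liftE_zero] at this
  rw [measure_mono_null _ hK]
  · simp
  · rintro _ ⟨t, ht, _, ⟨x, hx, rfl⟩, rfl⟩
    change (t • (x : Euc (d + 1))) 0 = 0
    have hx : (x : Euc (d + 1)) 0 = 0 := hx
    simp [hx]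

lemma map_pr_nice (d : ℕ) {μ : Measure (Sph d)} (hμ : NiceSphMeasure d μ) :
    NiceMeasure d (μ.map pr) := by
  obtain ⟨hp, f, hf, hpos, rfl⟩ := hμ
  refine ⟨Measure.isProbabilityMeasure_map measurable_pr.aemeasurable,
    fun y => dens y * (f (upS y) + f (-upS y)), ?_, ?_, ?_⟩
  · have := hf.comp (continuous_upS (d := d))
    have h2 := hf.comp (continuous_neg.comp (continuous_upS (d := d)))
    exact continuous_dens.mul (this.add h2)
  · intro y
    exact mul_pos (dens_pos y) (add_pos (hpos _) (hpos _))
  · set F : Sph d → ℝ≥0∞ := fun x => ENNReal.ofReal (f x) with hFdef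
    have hF : Measurable F := hf.measurable.ennreal_ofReal
    have hn : Measurable (fun x : Sph d => -x) := continuous_neg.measurable
    have hFn : Measurable (fun x => F (-x)) := hF.comp hn
    have hs : (volume : Measure (Euc d)).withDensity
        (fun y => ENNReal.ofReal (dens y * (f (upS y) + f (-upS y)))) =
        (volume : Measure (Euc d)).withDensity (fun y => ENNReal.ofReal (dens y) * F (upS y)) +
        (volume : Measure (Euc d)).withDensity (fun y => ENNReal.ofReal (dens y) * F (-upS y)) := by
      rw [← withDensity_add_left]
      · congr 1
        ext y
        rw [ENNReal.ofReal_mul (dens_pos y).le, ENNReal.ofReal_add (hpos _).le (hpos _).le, mul_add]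
        rfl
      · exact continuous_dens.measurable.ennreal_ofReal.mul (hF.comp continuous_upS.measurable)
    rw [hs, ← map_pr_pos d hF, ← map_pr_pos d hFn]
    ext C hC
    have hP := measurable_pr hC
    have hpS := measurableSet_posS d
    rw [Measure.add_apply, Measure.map_apply measurable_pr hC, Measure.map_apply measurable_pr hC,
      Measure.map_apply measurable_pr hC, Measure.restrict_apply hP, Measure.restrict_apply hP,
      ← measure_inter_add_sdiff _ hpS]
    congr 1
    have hneg : MeasurableSet {x : Sph d | -x ∈ posS d} := hn hpS
    have h1 : ((sphMeasure d).withDensity F) (pr ⁻¹' C \ posS d) =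
        ((sphMeasure d).withDensity F) (pr ⁻¹' C ∩ {x : Sph d | -x ∈ posS d}) := by
      apply measure_congr
      have : ∀ᵐ x : Sph d ∂((sphMeasure d).withDensity F), (x : Euc (d + 1)) 0 ≠ 0 := by
        apply withDensity_absolutelyContinuous
        refine (congrArg (sphMeasure d) ?_).trans (equator_null d)
        ext x
        simp
      filter_upwards [this] with x hx
      apply propext
      change (_ ∧ ¬ (0 < (x : Euc (d + 1)) 0)) ↔ (_ ∧ 0 < -((x : Euc (d + 1)) 0))
      refine and_congr_right fun _ => ?_
      rw [not_lt, neg_pos]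
      exact ⟨fun h => lt_of_le_of_ne h hx, le_of_lt⟩
    rw [h1, withDensity_apply _ (hP.inter hneg), withDensity_apply _ (hP.inter hpS)]
    conv_lhs => rw [← sph_map_neg d]
    rw [setLIntegral_map (hP.inter hneg) hF hn]
    congr 2
    ext x
    simp [pr, projE_neg]

/-- A hyperplane avoiding a closed convex body leaves it on one side. -/
lemma sign_of_avoid {d : ℕ} {C : Set (Euc d)} (hc : Convex ℝ C)
    (hi : (interior C).Nonempty) {v : Euc d} {c : ℝ} (h : Avoids (Hyperplane v c) C) :
    (∀ y ∈ C, c ≤ inner ℝ v y) ∨ (∀ y ∈ C, inner ℝ v y ≤ c) := by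
  have hcont : Continuous (fun y : Euc d => inner ℝ v y) := by fun_prop
  have hsub : C ⊆ closure (interior C) := by
    rw [hc.closure_interior_eq_closure_of_nonempty_interior hi]; exact subset_closure
  have hno : ∀ y ∈ interior C, inner ℝ v y ≠ c := by
    intro y hy he
    have : y ∈ Hyperplane v c ∩ interior C := ⟨he, hy⟩
    rw [h] at this
    exact this
  have key : (∀ y ∈ interior C, c ≤ inner ℝ v y) ∨ (∀ y ∈ interior C, inner ℝ v y ≤ c) := by
    by_contra! hcon
    obtain ⟨⟨a, ha, hac⟩, b, hb, hbc⟩ := hcon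
    obtain ⟨y, hy, hyc⟩ := hc.interior.isPreconnected.intermediate_value ha hb
      hcont.continuousOn ⟨hac.le, hbc.le⟩
    exact hno y hy hyc
  rcases key with hk | hk
  · left
    intro y hy
    exact closure_minimal (t := {y | c ≤ inner ℝ v y}) hk (isClosed_le continuous_const hcont)
      (hsub hy)
  · right
    intro y hy
    exact closure_minimal (t := {y | inner ℝ v y ≤ c}) hk (isClosed_le hcont continuous_const)
      (hsub hy)

/-- directions nonnegative on the lift of `C` -/
def sgP {d : ℕ} (C : Set (Euc d)) : Set (Sph d) :=
  {b | ∀ y ∈ C, 0 ≤ inner ℝ (liftE y) (b : Euc (d + 1))}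

/-- directions nonpositive on the lift of `C` -/
def sgN {d : ℕ} (C : Set (Euc d)) : Set (Sph d) :=
  {b | ∀ y ∈ C, inner ℝ (liftE y) (b : Euc (d + 1)) ≤ 0}

lemma isClosed_sgP {d : ℕ} (C : Set (Euc d)) : IsClosed (sgP C) := by
  have : sgP C = ⋂ y ∈ C, {b : Sph d | 0 ≤ inner ℝ (liftE y) (b : Euc (d + 1))} := by
    ext b; simp [sgP]
  rw [this]
  exact isClosed_biInter fun y _ => isClosed_le continuous_const (by fun_prop)

lemma isClosed_sgN {d : ℕ} (C : Set (Euc d)) : IsClosed (sgN C) := by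
  have : sgN C = ⋂ y ∈ C, {b : Sph d | inner ℝ (liftE y) (b : Euc (d + 1)) ≤ 0} := by
    ext b; simp [sgN]
  rw [this]
  exact isClosed_biInter fun y _ => isClosed_le (by fun_prop) continuous_const

lemma half_of_union {X : Type*} [MeasurableSpace X] (μ : Measure X) {A B : Set X} {r : ℝ}
    (h : ENNReal.ofReal r ≤ μ (A ∪ B)) :
    ENNReal.ofReal (r / 2) ≤ μ A ∨ ENNReal.ofReal (r / 2) ≤ μ B := by
  by_contra! hc
  have h1 := h.trans (measure_union_le A B)
  have h2 := ENNReal.add_lt_add hc.1 hc.2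
  rcases le_or_gt 0 r with hr | hr
  · rw [← ENNReal.ofReal_add (by positivity) (by positivity), add_halves] at h2
    exact absurd h1 (not_le.2 h2)
  · have := hc.1
    rw [ENNReal.ofReal_of_nonpos (by linarith)] at this
    exact absurd this not_lt_zero

lemma inner_smul_lift {d : ℕ} {a : Euc (d + 1)} (ha : a 0 ≠ 0) (b : Euc (d + 1)) :
    inner ℝ a b = a 0 * inner ℝ (liftE (projE a)) b := by
  rw [liftE_projE ha, real_inner_smul_left, ← mul_assoc, mul_inv_cancel₀ ha, one_mul]

lemma avoid_mem {d : ℕ} {C : Set (Euc d)} (hc : Convex ℝ C)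
    (hi : (interior C).Nonempty) {b : Sph d}
    (h : Avoids (Hyperplane (tailE (b : Euc (d + 1))) (-(b : Euc (d + 1)) 0)) C) :
    b ∈ sgP C ∪ sgN C := by
  have e : ∀ y : Euc d, inner ℝ (liftE y) (b : Euc (d + 1)) =
      (b : Euc (d + 1)) 0 + inner ℝ (tailE (b : Euc (d + 1))) y := by
    intro y
    rw [inner_split, liftE_zero, tailE_liftE, one_mul, real_inner_comm]
  rcases sign_of_avoid hc hi h with h | h
  · left
    intro y hy
    rw [e]; linarith [h y hy]
  · right
    intro y hy
    rw [e]; linarith [h y hy]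

lemma pole_mem {d : ℕ} (C : Set (Euc d)) {b : Sph d} (h : tailE (b : Euc (d + 1)) = 0) :
    b ∈ sgP C ∪ sgN C := by
  have e : ∀ y : Euc d, inner ℝ (liftE y) (b : Euc (d + 1)) = (b : Euc (d + 1)) 0 := by
    intro y
    rw [inner_split, liftE_zero, h]; simp
  rcases le_total 0 ((b : Euc (d + 1)) 0) with hb | hb
  · left; intro y _; rw [e]; exact hb
  · right; intro y _; rw [e]; exact hb

/-- Averaging. -/
lemma exists_large {X : Type*} [MeasurableSpace X] (μ : Measure X) [IsProbabilityMeasure μ]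
    {m k : ℕ} (hm : 0 < m) (T : Fin m → Set X) (hT : ∀ i, MeasurableSet (T i))
    (h : ∀ x, k ≤ {i | x ∈ T i}.ncard) : ∃ i, ENNReal.ofReal ((k : ℝ) / m) ≤ μ (T i) := by
  classical
  by_contra! hcon
  have h1 : (k : ℝ≥0∞) ≤ ∑ i, μ (T i) := by
    calc (k : ℝ≥0∞) = ∫⁻ _, (k : ℝ≥0∞) ∂μ := by simp
      _ ≤ ∫⁻ x, ∑ i, (T i).indicator 1 x ∂μ := by
          refine lintegral_mono fun x => ?_
          have : ∑ i, (T i).indicator (1 : X → ℝ≥0∞) x = ({i | x ∈ T i}.ncard : ℝ≥0∞) := by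
            rw [Set.ncard_eq_toFinset_card']
            simp [indicator]
          rw [this]
          exact Nat.cast_le.2 (h x)
      _ = ∑ i, μ (T i) := by
          rw [lintegral_finsetSum]
          · simp [hT]
          · intro i _
            exact measurable_one.indicator (hT i)
  have hne : (Finset.univ : Finset (Fin m)).Nonempty := ⟨⟨0, hm⟩, Finset.mem_univ _⟩
  have h2 : ∑ i, μ (T i) < ∑ _i : Fin m, ENNReal.ofReal ((k : ℝ) / m) :=
    ENNReal.sum_lt_sum_of_nonempty hne fun i _ => hcon i
  have h3 : ∑ _i : Fin m, ENNReal.ofReal ((k : ℝ) / m) = k := by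
    have : (m : ℝ) ≠ 0 := by positivity
    simp only [Finset.sum_const, Finset.card_univ, Fintype.card_fin, nsmul_eq_mul]
    rw [← ENNReal.ofReal_natCast m, ← ENNReal.ofReal_mul (by positivity), mul_div_cancel₀ _ this,
      ENNReal.ofReal_natCast]
  rw [h3] at h2
  exact absurd h1 (not_le.2 h2)

/-- If every nice measure on ℝ^d admits a family of m closed convex sets, each of
measure at least α, such that every hyperplane avoids at least k of them, then
(α/2, k/(2m)) ∈ C_d. -/
theorem convex_family_gives_pair (d k m : ℕ) (hd : 1 ≤ d) (hk : 1 ≤ k) (hm : 0 < m)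
    (α : ℝ) (hα : 0 < α) (h : HasConvexFamily d k m α) :
    (α / 2, (k : ℝ) / (2 * m)) ∈ CSet d := by
  refine ⟨by positivity, by positivity, ?_⟩
  intro μ1 μ2 hμ1 hμ2
  have hN := map_pr_nice d hμ1
  obtain ⟨F, hcl, hcv, hmass, hav⟩ := h _ hN
  have hnonempty : ∀ i, (interior (F i)).Nonempty := by
    intro i
    by_contra hne
    rw [not_nonempty_iff_eq_empty] at hne
    have h0 : (volume : Measure (Euc d)) (F i) = 0 := by
      have hfr := (hcv i).addHaar_frontier (volume : Measure (Euc d))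
      rwa [(hcl i).frontier_eq, hne, sdiff_empty] at hfr
    obtain ⟨_, f, _, _, he⟩ := hN
    have h1 : (μ1.map pr) (F i) = 0 := by
      rw [he]; exact withDensity_absolutelyContinuous _ _ h0
    have h2 := hmass i
    rw [h1, nonpos_iff_eq_zero, ENNReal.ofReal_eq_zero] at h2
    linarith
  have hkm : k ≤ m := by
    have hv : (EuclideanSpace.single ⟨0, hd⟩ 1 : Euc d) ≠ 0 := by
      simp
    refine (hav _ 0 hv).trans ?_
    refine (Set.ncard_le_card _).trans ?_
    simp
  have : IsProbabilityMeasure μ2 := hμ2.1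
  obtain ⟨i, hi⟩ := exists_large μ2 (k := k) hm (fun i => sgP (F i) ∪ sgN (F i))
    (fun i => ((isClosed_sgP _).union (isClosed_sgN _)).measurableSet) (by
      intro b
      by_cases hb : tailE (b : Euc (d + 1)) = 0
      · have : {i | b ∈ sgP (F i) ∪ sgN (F i)} = Set.univ :=
          eq_univ_of_forall fun i => pole_mem _ hb
        rw [this, Set.ncard_univ]
        simpa using hkm
      · refine (hav _ (-(b : Euc (d + 1)) 0) hb).trans ?_
        exact Set.ncard_le_ncard (fun i hi => avoid_mem (hcv i) (hnonempty i) hi) (Set.toFinite _))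
  have hB := half_of_union μ2 hi
  rw [show (k : ℝ) / m / 2 = (k : ℝ) / (2 * m) by rw [div_div, mul_comm]] at hB
  -- the two halves of the cone
  set Ap : Set (Sph d) := {a | 0 < (a : Euc (d + 1)) 0 ∧ pr a ∈ F i} with hAp
  set An : Set (Sph d) := {a | (a : Euc (d + 1)) 0 < 0 ∧ pr a ∈ F i} with hAn
  have hA := half_of_union μ1 (A := Ap) (B := An) (r := α) (by
    refine (hmass i).trans ?_
    rw [Measure.map_apply measurable_pr (hcl i).measurableSet]
    apply measure_mono_ae
    have : ∀ᵐ x : Sph d ∂μ1, (x : Euc (d + 1)) 0 ≠ 0 := by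
      obtain ⟨_, f, _, _, rfl⟩ := hμ1
      apply withDensity_absolutelyContinuous
      refine (congrArg (sphMeasure d) ?_).trans (equator_null d)
      ext x
      simp
    filter_upwards [this] with x hx hxF
    rcases lt_or_gt_of_ne hx with h | h
    · exact Or.inr ⟨h, hxF⟩
    · exact Or.inl ⟨h, hxF⟩)
  rcases hA with hA | hA <;> rcases hB with hB | hB
  · refine ⟨_, _, hA, hB, Or.inl ?_⟩
    rintro a ⟨ha, haF⟩ b hb
    rw [inner_smul_lift ha.ne']
    exact mul_nonneg ha.le (hb _ haF)
  · refine ⟨_, _, hA, hB, Or.inr ?_⟩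
    rintro a ⟨ha, haF⟩ b hb
    rw [inner_smul_lift ha.ne']
    exact mul_nonpos_of_nonneg_of_nonpos ha.le (hb _ haF)
  · refine ⟨_, _, hA, hB, Or.inr ?_⟩
    rintro a ⟨ha, haF⟩ b hb
    rw [inner_smul_lift ha.ne]
    exact mul_nonpos_of_nonpos_of_nonneg ha.le (hb _ haF)
  · refine ⟨_, _, hA, hB, Or.inl ?_⟩
    rintro a ⟨ha, haF⟩ b hb
    rw [inner_smul_lift ha.ne]
    exact mul_nonneg_of_nonpos_of_nonpos ha.le (hb _ haF)
end
end

section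
/- Let d ≥ 2 and let k_1, k_2 be non-negative integers, not both zero. Then the pair ( (1/2)·(1/2^d)^{k_1}·(1/(3·2^{d−1}))^{k_2} , (1/2)·(1 − (1 − 1/2^d)^{k_1}·(1 − 1/(3·2^{d−2}))^{k_2}) ) belongs to C_d. In particular (1/2^{d+1}, 1/2^{d+1}) ∈ C_d and (1/(3·2^d), 1/(3·2^{d−1})) ∈ C_d. -/
open MeasureTheory Set Metric
open scoped ENNReal
noncomputable section

section Abstract
variable {Ω : Type} [MeasurableSpace Ω]

/-- bounded measurable functions -/
def BdS (Ω : Type) [MeasurableSpace Ω] : Submodule ℝ (Ω → ℝ) where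
  carrier := {X | Measurable X ∧ ∃ K, ∀ ω, |X ω| ≤ K}
  add_mem' := by
    rintro X Y ⟨hX, K, hK⟩ ⟨hY, L, hL⟩
    refine ⟨hX.add hY, K + L, fun ω => ?_⟩
    exact (abs_add_le _ _).trans (add_le_add (hK ω) (hL ω))
  zero_mem' := ⟨measurable_const, 0, fun ω => by simp⟩
  smul_mem' := by
    rintro c X ⟨hX, K, hK⟩
    refine ⟨hX.const_smul c, |c| * K, fun ω => ?_⟩
    simp only [Pi.smul_apply, smul_eq_mul, abs_mul]
    exact mul_le_mul_of_nonneg_left (hK ω) (abs_nonneg c)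

lemma const_mem_BdS (t : ℝ) : (fun _ : Ω => t) ∈ BdS Ω :=
  ⟨measurable_const, |t|, fun _ => le_rfl⟩

structure IsFn (ν : Measure Ω) (S : Set Ω) (φ : (Ω → ℝ) → ℝ) : Prop where
  mono : ∀ X ∈ BdS Ω, ∀ Y ∈ BdS Ω, (∀ ω ∈ S, X ω ≤ Y ω) → φ X ≤ φ Y
  equiv : ∀ X ∈ BdS Ω, ∀ t : ℝ, φ (X + fun _ => t) = φ X + t
  lo : ∀ X ∈ BdS Ω, ∀ T ∈ BdS Ω, (∀ ω ∈ S, 0 ≤ T ω) → ν (S ∩ {ω | T ω = 0}) = 0 →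
    ∀ M : ℝ, ∃ u : ℝ, 0 ≤ u ∧ φ (X - u • T) ≤ M
  hi : ∀ X ∈ BdS Ω, ∀ T ∈ BdS Ω, (∀ ω ∈ S, 0 ≤ T ω) → ν (S ∩ {ω | T ω = 0}) = 0 →
    ∀ M : ℝ, ∃ u : ℝ, 0 ≤ u ∧ M ≤ φ (X + u • T)

lemma IsFn.continuous {ν : Measure Ω} {S : Set Ω} {φ : (Ω → ℝ) → ℝ} (h : IsFn ν S φ)
    {X T : Ω → ℝ} (hX : X ∈ BdS Ω) (hT : T ∈ BdS Ω) :
    Continuous (fun u : ℝ => φ (X - u • T)) := by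
  obtain ⟨-, K, hK⟩ := id hT
  have hm : ∀ u : ℝ, X - u • T ∈ BdS Ω := fun u => sub_mem hX (Submodule.smul_mem _ _ hT)
  have key : ∀ u v : ℝ, φ (X - u • T) ≤ φ (X - v • T) + |K| * |u - v| := by
    intro u v
    rw [← h.equiv _ (hm v)]
    refine h.mono _ (hm u) _ (add_mem (hm v) (const_mem_BdS _)) fun ω _ => ?_
    simp only [Pi.sub_apply, Pi.smul_apply, smul_eq_mul, Pi.add_apply]
    have h1 : |(v - u) * T ω| ≤ |K| * |u - v| := by
      rw [abs_mul, abs_sub_comm, mul_comm]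
      exact mul_le_mul_of_nonneg_right ((hK ω).trans (le_abs_self K)) (abs_nonneg _)
    have := (abs_le.1 h1).2
    linarith
  refine LipschitzWith.continuous (K := ⟨|K|, abs_nonneg K⟩) ?_
  refine LipschitzWith.of_le_add_mul _ fun u v => ?_
  rw [Real.dist_eq]
  exact key u v

lemma exists_cross {ν : Measure Ω} {S P N : Set Ω} {φ ψ : (Ω → ℝ) → ℝ} {Y : Ω → ℝ}
    (hφ : IsFn ν P φ) (hψ : IsFn ν N ψ) (hY : Y ∈ BdS Ω) (hPS : P ⊆ S) (hNS : N ⊆ S)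
    (hP : ∀ ω ∈ P, 0 ≤ Y ω) (hN : ∀ ω ∈ N, Y ω ≤ 0) (h0 : ν (S ∩ {ω | Y ω = 0}) = 0)
    {X : Ω → ℝ} (hX : X ∈ BdS Ω) :
    ∃ u : ℝ, φ (X - u • Y) = ψ (X - u • Y) := by
  have hm : ∀ u : ℝ, X - u • Y ∈ BdS Ω := fun u => sub_mem hX (Submodule.smul_mem _ _ hY)
  have hP0 : ν (P ∩ {ω | Y ω = 0}) = 0 := measure_mono_null (by gcongr) h0
  obtain ⟨u, hu, hu'⟩ := hφ.lo X hX Y hY hP hP0 (ψ (X - (0:ℝ) • Y))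
  obtain ⟨v, hv, hv'⟩ := hφ.hi X hX Y hY hP hP0 (ψ (X - (0:ℝ) • Y))
  have h1 : φ (X - u • Y) ≤ ψ (X - u • Y) := by
    refine hu'.trans (hψ.mono _ (hm 0) _ (hm u) fun ω hω => ?_)
    have := hN ω hω
    simp only [Pi.sub_apply, Pi.smul_apply, smul_eq_mul]
    nlinarith
  have h2 : ψ (X - (-v) • Y) ≤ φ (X - (-v) • Y) := by
    refine (hψ.mono _ (hm (-v)) _ (hm 0) fun ω hω => ?_).trans (hv'.trans (le_of_eq ?_))
    · have := hN ω hω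
      simp only [Pi.sub_apply, Pi.smul_apply, smul_eq_mul]
      nlinarith
    · simp
  obtain ⟨w, hw⟩ := mem_range_of_exists_le_of_exists_ge
    ((hφ.continuous hX hY).sub (hψ.continuous hX hY)) (c := 0)
    ⟨u, by simpa using h1⟩ ⟨-v, by simpa using h2⟩
  exact ⟨w, by simpa [sub_eq_zero] using hw⟩

lemma exists_joint {ν : Measure Ω} {S P N : Set Ω} {φ ψ : (Ω → ℝ) → ℝ} {Y : Ω → ℝ}
    (hφ : IsFn ν P φ) (hψ : IsFn ν N ψ) (hY : Y ∈ BdS Ω) (hPS : P ⊆ S) (hNS : N ⊆ S)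
    (hP : ∀ ω ∈ P, 0 ≤ Y ω) (hN : ∀ ω ∈ N, Y ω ≤ 0) (h0 : ν (S ∩ {ω | Y ω = 0}) = 0) :
    ∃ θ : (Ω → ℝ) → ℝ, IsFn ν S θ ∧
      ∀ X ∈ BdS Ω, ∃ u : ℝ, φ (X - u • Y) = θ X ∧ ψ (X - u • Y) = θ X := by
  have hc : ∀ X : Ω → ℝ, ∃ u : ℝ, X ∈ BdS Ω → φ (X - u • Y) = ψ (X - u • Y) := by
    intro X
    by_cases hX : X ∈ BdS Ω
    · obtain ⟨u, hu⟩ := exists_cross hφ hψ hY hPS hNS hP hN h0 hX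
      exact ⟨u, fun _ => hu⟩
    · exact ⟨0, fun h => absurd h hX⟩
  choose U hU using hc
  have hm : ∀ X ∈ BdS Ω, ∀ u : ℝ, X - u • Y ∈ BdS Ω :=
    fun X hX u => sub_mem hX (Submodule.smul_mem _ _ hY)
  have up : ∀ X ∈ BdS Ω, ∀ v M : ℝ, φ (X - v • Y) ≤ M → ψ (X - v • Y) ≤ M →
      φ (X - U X • Y) ≤ M := by
    intro X hX v M h1 h2
    rcases le_total v (U X) with h | h
    · refine le_trans (hφ.mono _ (hm X hX _) _ (hm X hX _) fun ω hω => ?_) h1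
      have := hP ω hω
      simp only [Pi.sub_apply, Pi.smul_apply, smul_eq_mul]
      nlinarith
    · rw [hU X hX]
      refine le_trans (hψ.mono _ (hm X hX _) _ (hm X hX _) fun ω hω => ?_) h2
      have := hN ω hω
      simp only [Pi.sub_apply, Pi.smul_apply, smul_eq_mul]
      nlinarith
  have dn : ∀ X ∈ BdS Ω, ∀ v M : ℝ, M ≤ φ (X - v • Y) → M ≤ ψ (X - v • Y) →
      M ≤ φ (X - U X • Y) := by
    intro X hX v M h1 h2
    rcases le_total v (U X) with h | h
    · rw [hU X hX]
      refine h2.trans (hψ.mono _ (hm X hX _) _ (hm X hX _) fun ω hω => ?_)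
      have := hN ω hω
      simp only [Pi.sub_apply, Pi.smul_apply, smul_eq_mul]
      nlinarith
    · refine h1.trans (hφ.mono _ (hm X hX _) _ (hm X hX _) fun ω hω => ?_)
      have := hP ω hω
      simp only [Pi.sub_apply, Pi.smul_apply, smul_eq_mul]
      nlinarith
  refine ⟨fun X => φ (X - U X • Y), ⟨?_, ?_, ?_, ?_⟩, fun X hX => ⟨U X, rfl, (hU X hX).symm⟩⟩
  · intro X hX X' hX' hle
    refine up X hX (U X') _ ?_ ?_
    · refine hφ.mono _ (hm X hX _) _ (hm X' hX' _) fun ω hω => ?_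
      simpa using hle ω (hPS hω)
    · rw [hU X' hX']
      refine hψ.mono _ (hm X hX _) _ (hm X' hX' _) fun ω hω => ?_
      simpa using hle ω (hNS hω)
  · intro X hX t
    have e : ∀ v : ℝ, (X + fun _ => t) - v • Y = (X - v • Y) + fun _ => t := by
      intro v; abel
    have hXt := add_mem hX (const_mem_BdS (Ω := Ω) t)
    apply le_antisymm
    · refine up _ hXt (U X) _ ?_ ?_
      · rw [e, hφ.equiv _ (hm X hX _)]
      · rw [e, hψ.equiv _ (hm X hX _), hU X hX]
    · refine dn _ hXt (U X) _ ?_ ?_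
      · rw [e, hφ.equiv _ (hm X hX _)]
      · rw [e, hψ.equiv _ (hm X hX _), hU X hX]
  · intro X hX T hT hT0 hTn M
    have hT' : ∀ u : ℝ, X - u • T ∈ BdS Ω := fun u => sub_mem hX (Submodule.smul_mem _ _ hT)
    obtain ⟨u, hu, hu'⟩ := hφ.lo X hX T hT (fun ω h => hT0 ω (hPS h))
      (measure_mono_null (by gcongr) hTn) M
    obtain ⟨v, hv, hv'⟩ := hψ.lo X hX T hT (fun ω h => hT0 ω (hNS h))
      (measure_mono_null (by gcongr) hTn) M
    refine ⟨max u v, le_max_of_le_left hu, up _ (hT' _) 0 _ ?_ ?_⟩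
    · refine le_trans (hφ.mono _ (hm _ (hT' _) _) _ (hT' u) fun ω hω => ?_) hu'
      have := hT0 ω (hPS hω)
      have := le_max_left u v
      simp only [Pi.sub_apply, Pi.smul_apply, smul_eq_mul]
      nlinarith
    · refine le_trans (hψ.mono _ (hm _ (hT' _) _) _ (hT' v) fun ω hω => ?_) hv'
      have := hT0 ω (hNS hω)
      have := le_max_right u v
      simp only [Pi.sub_apply, Pi.smul_apply, smul_eq_mul]
      nlinarith
  · intro X hX T hT hT0 hTn M
    have hT' : ∀ u : ℝ, X + u • T ∈ BdS Ω := fun u => add_mem hX (Submodule.smul_mem _ _ hT)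
    obtain ⟨u, hu, hu'⟩ := hφ.hi X hX T hT (fun ω h => hT0 ω (hPS h))
      (measure_mono_null (by gcongr) hTn) M
    obtain ⟨v, hv, hv'⟩ := hψ.hi X hX T hT (fun ω h => hT0 ω (hNS h))
      (measure_mono_null (by gcongr) hTn) M
    refine ⟨max u v, le_max_of_le_left hu, dn _ (hT' _) 0 _ ?_ ?_⟩
    · refine hu'.trans (hφ.mono _ (hT' u) _ (hm _ (hT' _) _) fun ω hω => ?_)
      have := hT0 ω (hPS hω)
      have := le_max_left u v
      simp only [Pi.sub_apply, Pi.smul_apply, smul_eq_mul, Pi.add_apply]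
      nlinarith
    · refine hv'.trans (hψ.mono _ (hT' v) _ (hm _ (hT' _) _) fun ω hω => ?_)
      have := hT0 ω (hNS hω)
      have := le_max_right u v
      simp only [Pi.sub_apply, Pi.smul_apply, smul_eq_mul, Pi.add_apply]
      nlinarith

lemma inter_le_mono {S : Set Ω} {f g : Ω → ℝ} {a b : ℝ} (h : ∀ ω ∈ S, f ω ≤ a → g ω ≤ b) :
    S ∩ {ω | f ω ≤ a} ⊆ S ∩ {ω | g ω ≤ b} := by
  rintro ω ⟨h1, h2⟩
  exact ⟨h1, h ω h1 h2⟩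

/-- lower quantile -/
def quant (ν : Measure Ω) (S : Set Ω) (l : ℝ) (X : Ω → ℝ) : ℝ :=
  sInf {c : ℝ | l * ν.real S ≤ ν.real (S ∩ {ω | X ω ≤ c})}

section quant
variable {ν : Measure Ω} [IsFiniteMeasure ν] {S : Set Ω} {l : ℝ}

lemma quant_bdd (hS : 0 < ν.real S) (hl : 0 < l) {X : Ω → ℝ} (hX : X ∈ BdS Ω) :
    BddBelow {c : ℝ | l * ν.real S ≤ ν.real (S ∩ {ω | X ω ≤ c})} := by
  obtain ⟨-, K, hK⟩ := hX
  refine ⟨-K, fun c hc => ?_⟩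
  by_contra! h
  have : S ∩ {ω | X ω ≤ c} = ∅ := by
    ext ω
    simp only [mem_inter_iff, mem_ofPred_eq, mem_empty_iff_false, iff_false, not_and, not_le]
    intro _
    have := (abs_le.1 (hK ω)).1
    linarith
  simp only [mem_ofPred_eq, this, measureReal_empty] at hc
  nlinarith [mul_pos hl hS]

lemma quant_ne (hS : 0 < ν.real S) (hl : l < 1) {X : Ω → ℝ} (hX : X ∈ BdS Ω) :
    {c : ℝ | l * ν.real S ≤ ν.real (S ∩ {ω | X ω ≤ c})}.Nonempty := by
  obtain ⟨-, K, hK⟩ := hX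
  refine ⟨K, ?_⟩
  have : S ∩ {ω | X ω ≤ K} = S := by
    ext ω
    simp only [mem_inter_iff, mem_ofPred_eq, and_iff_left_iff_imp]
    intro _
    exact (abs_le.1 (hK ω)).2
  simp only [mem_ofPred_eq, this]
  nlinarith

lemma quant_le (hS : 0 < ν.real S) (hl : 0 < l) {X : Ω → ℝ} (hX : X ∈ BdS Ω) {c : ℝ}
    (hc : l * ν.real S ≤ ν.real (S ∩ {ω | X ω ≤ c})) : quant ν S l X ≤ c :=
  csInf_le (quant_bdd hS hl hX) hc

lemma le_quant (hS : 0 < ν.real S) (hl : l < 1) {X : Ω → ℝ} (hX : X ∈ BdS Ω) {M : ℝ}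
    (hc : ν.real (S ∩ {ω | X ω ≤ M}) < l * ν.real S) : M ≤ quant ν S l X := by
  refine le_csInf (quant_ne hS hl hX) fun c hcc => ?_
  by_contra! h
  have : ν.real (S ∩ {ω | X ω ≤ c}) ≤ ν.real (S ∩ {ω | X ω ≤ M}) := by
    exact measureReal_mono (inter_le_mono fun ω hωS hω => le_trans hω h.le)
  simp only [mem_ofPred_eq] at hcc
  linarith

lemma quant_mass_le (hSm : MeasurableSet S) (hS : 0 < ν.real S) (hl : 0 < l) (hl1 : l < 1)
    {X : Ω → ℝ} (hX : X ∈ BdS Ω) :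
    l * ν.real S ≤ ν.real (S ∩ {ω | X ω ≤ quant ν S l X}) := by
  set q := quant ν S l X
  have hlim : Filter.Tendsto (fun n : ℕ => ν (S ∩ {ω | X ω ≤ q + 1 / ((n : ℝ) + 1)})) Filter.atTop
      (nhds (ν (⋂ n : ℕ, S ∩ {ω | X ω ≤ q + 1 / ((n : ℝ) + 1)}))) := by
    apply tendsto_measure_iInter_atTop
    · intro n
      exact (hSm.inter (measurableSet_le hX.1 measurable_const)).nullMeasurableSet
    · intro a b hab
      refine inter_le_mono fun ω hS hω => le_trans hω ?_
      have : 1 / ((b : ℝ) + 1) ≤ 1 / ((a : ℝ) + 1) := by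
        apply one_div_le_one_div_of_le (by positivity)
        have : (a : ℝ) ≤ b := by exact_mod_cast hab
        linarith
      linarith
    · exact ⟨0, measure_ne_top _ _⟩
  have he : (⋂ n : ℕ, S ∩ {ω | X ω ≤ q + 1 / ((n : ℝ) + 1)}) = S ∩ {ω | X ω ≤ q} := by
    ext ω
    simp only [mem_iInter, mem_inter_iff, mem_ofPred_eq]
    constructor
    · intro h
      refine ⟨(h 0).1, ?_⟩
      refine le_of_forall_pos_le_add fun ε hε => ?_
      obtain ⟨n, hn⟩ := exists_nat_one_div_lt hε
      linarith [(h n).2]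
    · rintro ⟨h1, h2⟩ n
      have : 0 < 1 / ((n : ℝ) + 1) := by positivity
      exact ⟨h1, by linarith⟩
  rw [he] at hlim
  have hlim' := (ENNReal.tendsto_toReal (measure_ne_top ν _)).comp hlim
  refine ge_of_tendsto' hlim' fun n => ?_
  obtain ⟨c, hc, hcq⟩ := exists_lt_of_csInf_lt (quant_ne hS hl1 hX)
    (show quant ν S l X < q + 1 / ((n : ℝ) + 1) by
      have : 0 < 1 / ((n : ℝ) + 1) := by positivity
      simp only [q]; linarith)
  refine le_trans hc ?_
  exact measureReal_mono (inter_le_mono fun ω hωS hω => le_trans hω hcq.le)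

lemma quant_mass_lt (hSm : MeasurableSet S) (hS : 0 < ν.real S) (hl : 0 < l) (hl1 : l < 1)
    {X : Ω → ℝ} (hX : X ∈ BdS Ω) :
    ν.real (S ∩ {ω | X ω < quant ν S l X}) ≤ l * ν.real S := by
  set q := quant ν S l X
  have hlim : Filter.Tendsto (fun n : ℕ => ν (S ∩ {ω | X ω ≤ q - 1 / ((n : ℝ) + 1)})) Filter.atTop
      (nhds (ν (⋃ n : ℕ, S ∩ {ω | X ω ≤ q - 1 / ((n : ℝ) + 1)}))) := by
    apply tendsto_measure_iUnion_atTop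
    intro a b hab
    refine inter_le_mono fun ω hS hω => le_trans hω ?_
    have : 1 / ((b : ℝ) + 1) ≤ 1 / ((a : ℝ) + 1) := by
      apply one_div_le_one_div_of_le (by positivity)
      have : (a : ℝ) ≤ b := by exact_mod_cast hab
      linarith
    linarith
  have he : (⋃ n : ℕ, S ∩ {ω | X ω ≤ q - 1 / ((n : ℝ) + 1)}) = S ∩ {ω | X ω < q} := by
    ext ω
    simp only [mem_iUnion, mem_inter_iff, mem_ofPred_eq]
    constructor
    · rintro ⟨n, h1, h2⟩
      have : 0 < 1 / ((n : ℝ) + 1) := by positivity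
      exact ⟨h1, by linarith⟩
    · rintro ⟨h1, h2⟩
      obtain ⟨n, hn⟩ := exists_nat_one_div_lt (sub_pos.2 h2)
      exact ⟨n, h1, by linarith⟩
  rw [he] at hlim
  have hlim' := (ENNReal.tendsto_toReal (measure_ne_top ν _)).comp hlim
  refine le_of_tendsto' hlim' fun n => ?_
  by_contra! h
  have h1 := quant_le hS hl hX h.le
  have : 0 < 1 / ((n : ℝ) + 1) := by positivity
  simp only [q] at h1
  linarith

lemma quant_mass_ge (hSm : MeasurableSet S) (hS : 0 < ν.real S) (hl : 0 < l) (hl1 : l < 1)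
    {X : Ω → ℝ} (hX : X ∈ BdS Ω) :
    (1 - l) * ν.real S ≤ ν.real (S ∩ {ω | quant ν S l X ≤ X ω}) := by
  have h := quant_mass_lt hSm hS hl hl1 hX
  have : ν.real S ≤ ν.real (S ∩ {ω | X ω < quant ν S l X}) +
      ν.real (S ∩ {ω | quant ν S l X ≤ X ω}) := by
    refine le_trans (measureReal_mono ?_) (measureReal_union_le _ _)
    intro ω hω
    rcases lt_or_ge (X ω) (quant ν S l X) with h | h
    · exact Or.inl ⟨hω, h⟩
    · exact Or.inr ⟨hω, h⟩
  linarith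

lemma quant_isFn (hSm : MeasurableSet S) (hS : 0 < ν.real S) (hl : 0 < l) (hl1 : l < 1) :
    IsFn ν S (quant ν S l) := by
  refine ⟨?_, ?_, ?_, ?_⟩
  · intro X hX Y hY hle
    refine csInf_le_csInf (quant_bdd hS hl hX) (quant_ne hS hl1 hY) fun c hc => ?_
    refine le_trans hc (measureReal_mono (inter_le_mono fun ω hωS hω => (hle ω hωS).trans hω))
  · have key : ∀ X ∈ BdS Ω, ∀ t : ℝ, quant ν S l (X + fun _ => t) ≤ quant ν S l X + t := by
      intro X hX t
      refine quant_le hS hl (add_mem hX (const_mem_BdS t)) ?_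
      refine (quant_mass_le hSm hS hl hl1 hX).trans (measureReal_mono ?_)
      intro ω hω
      refine ⟨hω.1, ?_⟩
      have := hω.2
      simp only [mem_ofPred_eq, Pi.add_apply] at *
      linarith
    intro X hX t
    refine le_antisymm (key X hX t) ?_
    have := key _ (add_mem hX (const_mem_BdS t)) (-t)
    have e : (X + fun _ => t) + (fun _ => -t) = X := by
      ext; simp
    rw [e] at this
    linarith
  · intro X hX T hT hT0 hTn M
    obtain ⟨hXm, K, hK⟩ := id hX
    have hlim : Filter.Tendsto (fun n : ℕ => ν (S ∩ {ω | K - n * T ω ≤ M})) Filter.atTop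
        (nhds (ν (⋃ n : ℕ, S ∩ {ω | K - n * T ω ≤ M}))) := by
      apply tendsto_measure_iUnion_atTop
      intro a b hab
      refine inter_le_mono fun ω hωS hω => le_trans ?_ hω
      have : (a : ℝ) ≤ b := by exact_mod_cast hab
      nlinarith [hT0 ω hωS]
    have hbig : ν S ≤ ν (⋃ n : ℕ, S ∩ {ω | K - n * T ω ≤ M}) := by
      have : S ⊆ (⋃ n : ℕ, S ∩ {ω | K - n * T ω ≤ M}) ∪ (S ∩ {ω | T ω = 0}) := by
        intro ω hω
        by_cases h : T ω = 0
        · exact Or.inr ⟨hω, h⟩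
        · left
          have hp : 0 < T ω := lt_of_le_of_ne (hT0 ω hω) (Ne.symm h)
          obtain ⟨n, hn⟩ := exists_nat_ge ((K - M) / T ω)
          rw [div_le_iff₀ hp] at hn
          exact mem_iUnion.2 ⟨n, hω, by simp only [mem_ofPred_eq]; linarith⟩
      refine (measure_mono this).trans ((measure_union_le _ _).trans ?_)
      rw [hTn, add_zero]
    have hlim' := (ENNReal.tendsto_toReal (measure_ne_top ν _)).comp hlim
    have hlt : l * ν.real S < (ν (⋃ n : ℕ, S ∩ {ω | K - n * T ω ≤ M})).toReal := by
      have : ν.real S ≤ (ν (⋃ n : ℕ, S ∩ {ω | K - n * T ω ≤ M})).toReal :=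
        ENNReal.toReal_mono (measure_ne_top _ _) hbig
      nlinarith
    obtain ⟨n, hn⟩ := (hlim'.eventually_const_lt hlt).exists
    refine ⟨n, by positivity, quant_le hS hl (sub_mem hX (Submodule.smul_mem _ _ hT)) ?_⟩
    refine le_trans (le_of_lt hn) (measureReal_mono (inter_le_mono fun ω hωS hω => le_trans ?_ hω))
    simp only [Pi.sub_apply, Pi.smul_apply, smul_eq_mul]
    linarith [(abs_le.1 (hK ω)).2]
  · intro X hX T hT hT0 hTn M
    obtain ⟨hXm, K, hK⟩ := id hX
    have hlim : Filter.Tendsto (fun n : ℕ => ν (S ∩ {ω | -K + n * T ω ≤ M})) Filter.atTop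
        (nhds (ν (⋂ n : ℕ, S ∩ {ω | -K + n * T ω ≤ M}))) := by
      apply tendsto_measure_iInter_atTop
      · intro n
        exact (hSm.inter (measurableSet_le (measurable_const.add (hT.1.const_mul _))
          measurable_const)).nullMeasurableSet
      · intro a b hab
        refine inter_le_mono fun ω hωS hω => le_trans ?_ hω
        have : (a : ℝ) ≤ b := by exact_mod_cast hab
        nlinarith [hT0 ω hωS]
      · exact ⟨0, measure_ne_top _ _⟩
    have hsm : ν (⋂ n : ℕ, S ∩ {ω | -K + n * T ω ≤ M}) = 0 := by
      refine measure_mono_null ?_ hTn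
      intro ω hω
      rw [mem_iInter] at hω
      refine ⟨(hω 0).1, ?_⟩
      by_contra h
      have hp : 0 < T ω := lt_of_le_of_ne (hT0 ω (hω 0).1) (Ne.symm h)
      obtain ⟨n, hn⟩ := exists_nat_gt ((K + M) / T ω)
      rw [div_lt_iff₀ hp] at hn
      have := (hω n).2
      simp only [mem_ofPred_eq] at this
      linarith
    rw [hsm] at hlim
    have hlim' := (ENNReal.tendsto_toReal ENNReal.zero_ne_top).comp hlim
    have hlt : (0 : ℝ≥0∞).toReal < l * ν.real S := by
      simpa using mul_pos hl hS
    obtain ⟨n, hn⟩ := (hlim'.eventually_lt_const hlt).exists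
    refine ⟨n, by positivity, le_quant hS hl1 (add_mem hX (Submodule.smul_mem _ _ hT)) ?_⟩
    refine lt_of_le_of_lt (measureReal_mono (inter_le_mono fun ω hωS hω => le_trans ?_ hω)) hn
    simp only [Pi.add_apply, Pi.smul_apply, smul_eq_mul]
    linarith [(abs_le.1 (hK ω)).1]

end quant
end Abstract


section Levels
variable {Ω : Type} [MeasurableSpace Ω]

def Wsp (X : ℕ → Ω → ℝ) : ℕ → Submodule ℝ (Ω → ℝ)
  | 0 => Submodule.span ℝ {fun _ => 1}
  | j + 1 => Wsp X j ⊔ Submodule.span ℝ {X j}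

lemma mem_Wsp_succ {X : ℕ → Ω → ℝ} {j : ℕ} {f : Ω → ℝ} :
    f ∈ Wsp X (j + 1) ↔ ∃ g ∈ Wsp X j, ∃ a : ℝ, f = g + a • X j := by
  simp only [Wsp, Submodule.mem_sup, Submodule.mem_span_singleton]
  constructor
  · rintro ⟨g, hg, z, ⟨a, rfl⟩, rfl⟩
    exact ⟨g, hg, a, rfl⟩
  · rintro ⟨g, hg, a, rfl⟩
    exact ⟨g, hg, _, ⟨a, rfl⟩, rfl⟩

lemma mem_Wsp_zero {X : ℕ → Ω → ℝ} {f : Ω → ℝ} :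
    f ∈ Wsp X 0 ↔ ∃ a : ℝ, f = fun _ => a := by
  simp only [Wsp, Submodule.mem_span_singleton]
  constructor
  · rintro ⟨a, rfl⟩
    exact ⟨a, by ext; simp⟩
  · rintro ⟨a, rfl⟩
    exact ⟨a, by ext; simp⟩

lemma Wsp_le_succ (X : ℕ → Ω → ℝ) (j : ℕ) : Wsp X j ≤ Wsp X (j + 1) := le_sup_left

lemma self_mem_Wsp (X : ℕ → Ω → ℝ) (j : ℕ) : X j ∈ Wsp X (j + 1) :=
  mem_Wsp_succ.2 ⟨0, zero_mem _, 1, by simp⟩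

lemma const_mem_Wsp (X : ℕ → Ω → ℝ) (j : ℕ) (t : ℝ) : (fun _ => t) ∈ Wsp X j := by
  induction j with
  | zero => exact mem_Wsp_zero.2 ⟨t, rfl⟩
  | succ j ih => exact Wsp_le_succ X j ih

lemma Wsp_le_BdS {X : ℕ → Ω → ℝ} (hX : ∀ j, X j ∈ BdS Ω) (j : ℕ) : Wsp X j ≤ BdS Ω := by
  induction j with
  | zero =>
    intro f hf
    obtain ⟨a, rfl⟩ := mem_Wsp_zero.1 hf
    exact const_mem_BdS a
  | succ j ih =>
    intro f hf
    obtain ⟨g, hg, a, rfl⟩ := mem_Wsp_succ.1 hf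
    exact add_mem (ih hg) (Submodule.smul_mem _ _ (hX j))

structure Lev (ν : Measure Ω) (X : ℕ → Ω → ℝ) (m : ℕ) {ι : Type} (S : ι → Set Ω)
    (K : Submodule ℝ (ι → Ω → ℝ)) : Prop where
  meas : ∀ i, MeasurableSet (S i)
  mass : ∀ i, ν.real univ ≤ 2 ^ m * ν.real (S i)
  pos : ∀ h ∈ K, ∃ i, ∀ ω ∈ S i, 0 ≤ h i ω
  solve : ∀ φ : ι → (Ω → ℝ) → ℝ, (∀ i, IsFn ν (S i) (φ i)) → ∀ Z ∈ BdS Ω,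
    ∃ h ∈ K, ∃ c : ℝ, ∀ i, φ i (Z - h i) = c
  rep : ∀ f ∈ Wsp X m, ∃ γ : ℝ, ∃ h ∈ K, ∀ i, f = (fun _ => γ) + h i
  sub : ∀ h ∈ K, ∀ i, h i ∈ Wsp X m

/-- the shear space after one more splitting -/
def extK {ι : Type} (K : Submodule ℝ (ι → Ω → ℝ)) (Y : ι → Ω → ℝ) :
    Submodule ℝ (ι × Bool → Ω → ℝ) where
  carrier := {g | ∃ h ∈ K, ∃ κ : ι → ℝ, ∀ i b, g (i, b) = h i + κ i • Y i}
  add_mem' := by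
    rintro g g' ⟨h, hh, κ, hg⟩ ⟨h', hh', κ', hg'⟩
    refine ⟨h + h', add_mem hh hh', κ + κ', fun i b => ?_⟩
    simp only [Pi.add_apply, hg, hg', add_smul]
    abel
  zero_mem' := ⟨0, zero_mem _, 0, fun i b => by simp⟩
  smul_mem' := by
    rintro c g ⟨h, hh, κ, hg⟩
    refine ⟨c • h, Submodule.smul_mem _ _ hh, c • κ, fun i b => ?_⟩
    simp only [Pi.smul_apply, hg, smul_add, smul_assoc]

def NullH (ν : Measure Ω) (X : ℕ → Ω → ℝ) (d : ℕ) : Prop :=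
  ∀ j < d, ∀ g ∈ Wsp X j, ν {ω | X j ω = g ω} = 0

lemma Lev.cell_pos {ν : Measure Ω} {X : ℕ → Ω → ℝ} {m : ℕ} {ι : Type} {S : ι → Set Ω}
    {K : Submodule ℝ (ι → Ω → ℝ)} (L : Lev ν X m S K) (h0 : 0 < ν.real univ) (i : ι) :
    0 < ν.real (S i) := by
  have := L.mass i
  have h2 : (0:ℝ) < 2 ^ m := by positivity
  by_contra! h
  nlinarith

lemma lev_exists (ν : Measure Ω) [IsFiniteMeasure ν] (h0 : 0 < ν.real univ) (X : ℕ → Ω → ℝ)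
    (hX : ∀ j, X j ∈ BdS Ω) (d : ℕ) (hN : NullH ν X d) (m : ℕ) (hm : m ≤ d) :
    ∃ (ι : Type) (_ : Fintype ι) (S : ι → Set Ω) (K : Submodule ℝ (ι → Ω → ℝ)),
      Fintype.card ι = 2 ^ m ∧ Lev ν X m S K := by
  induction m with
  | zero =>
    refine ⟨Unit, inferInstance, fun _ => univ, ⊥, by simp, ?_⟩
    refine ⟨fun _ => MeasurableSet.univ, by simp, ?_, ?_, ?_, ?_⟩
    · intro h hh
      rw [Submodule.mem_bot] at hh
      subst hh
      exact ⟨(), fun ω _ => le_rfl⟩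
    · intro φ _ Z _
      exact ⟨0, zero_mem _, φ () Z, fun i => by simp⟩
    · intro f hf
      obtain ⟨a, rfl⟩ := mem_Wsp_zero.1 hf
      exact ⟨a, 0, zero_mem _, fun i => by simp⟩
    · intro h hh i
      rw [Submodule.mem_bot] at hh
      subst hh
      exact zero_mem _
  | succ m ih =>
    obtain ⟨ι, _, S, K, hcard, L⟩ := ih (by omega)
    have hSp := L.cell_pos h0
    obtain ⟨k, hk, c, hc⟩ := L.solve (fun i => quant ν (S i) (1/2))
      (fun i => quant_isFn (L.meas i) (hSp i) (by norm_num) (by norm_num)) (X m) (hX m)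
    have hkB : ∀ i, k i ∈ BdS Ω := fun i => Wsp_le_BdS hX m (L.sub k hk i)
    have hXk : ∀ i, X m - k i ∈ BdS Ω := fun i => sub_mem (hX m) (hkB i)
    set Y : ι → Ω → ℝ := fun i => X m - k i - fun _ => c with hYdef
    have hY : ∀ i, Y i ∈ BdS Ω := fun i => sub_mem (hXk i) (const_mem_BdS c)
    have hYW : ∀ i, Y i ∈ Wsp X (m + 1) := fun i => sub_mem (sub_mem (self_mem_Wsp X m)
      (Wsp_le_succ X m (L.sub k hk i))) (const_mem_Wsp X _ c)
    have hYn : ∀ i, ν (S i ∩ {ω | Y i ω = 0}) = 0 := by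
      intro i
      refine measure_mono_null ?_ (hN m (by omega) (k i + fun _ => c)
        (add_mem (L.sub k hk i) (const_mem_Wsp X m c)))
      rintro ω ⟨-, h⟩
      simp only [hYdef, mem_ofPred_eq, Pi.sub_apply, Pi.add_apply] at h ⊢
      linarith
    let S' : ι × Bool → Set Ω := fun p =>
      if p.2 then S p.1 ∩ {ω | 0 ≤ Y p.1 ω} else S p.1 ∩ {ω | Y p.1 ω ≤ 0}
    have hmem : ∀ i ω, ω ∈ S' (i, true) ↔ ω ∈ S i ∧ 0 ≤ Y i ω := fun i ω => by
      simp [S']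
    have hmem' : ∀ i ω, ω ∈ S' (i, false) ↔ ω ∈ S i ∧ Y i ω ≤ 0 := fun i ω => by
      simp [S']
    refine ⟨ι × Bool, inferInstance, S', extK K Y, ?_, ?_, ?_, ?_, ?_, ?_, ?_⟩
    · rw [Fintype.card_prod, hcard, Fintype.card_bool, pow_succ]
    · rintro ⟨i, b⟩
      cases b
      · exact (L.meas i).inter (measurableSet_le (hY i).1 measurable_const)
      · exact (L.meas i).inter (measurableSet_le measurable_const (hY i).1)
    · rintro ⟨i, b⟩
      refine (L.mass i).trans ?_
      rw [pow_succ, mul_assoc]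
      refine mul_le_mul_of_nonneg_left ?_ (by positivity)
      have hci := hc i
      cases b
      · have h := quant_mass_le (l := 1/2) (L.meas i) (hSp i) (by norm_num) (by norm_num) (hXk i)
        rw [hci] at h
        have e : S i ∩ {ω | (X m - k i) ω ≤ c} = S' (i, false) := by
          ext ω
          simp [hmem', hYdef]
        rw [e] at h
        linarith
      · have h := quant_mass_ge (l := 1/2) (L.meas i) (hSp i) (by norm_num) (by norm_num) (hXk i)
        rw [hci] at h
        have e : S i ∩ {ω | c ≤ (X m - k i) ω} = S' (i, true) := by
          ext ω
          simp [hmem, hYdef]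
        rw [e] at h
        linarith
    · rintro g ⟨h, hh, κ, hg⟩
      obtain ⟨i, hi⟩ := L.pos h hh
      rcases le_total 0 (κ i) with hκ | hκ
      · refine ⟨(i, true), fun ω hω => ?_⟩
        obtain ⟨h1, h2⟩ := (hmem i ω).1 hω
        rw [hg]
        exact add_nonneg (hi ω h1) (mul_nonneg hκ h2)
      · refine ⟨(i, false), fun ω hω => ?_⟩
        obtain ⟨h1, h2⟩ := (hmem' i ω).1 hω
        rw [hg]
        exact add_nonneg (hi ω h1) (mul_nonneg_of_nonpos_of_nonpos hκ h2)
    · intro φ hφ Z hZ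
      have hj : ∀ i, ∃ θ : (Ω → ℝ) → ℝ, IsFn ν (S i) θ ∧ ∀ X ∈ BdS Ω, ∃ u : ℝ,
          φ (i, true) (X - u • Y i) = θ X ∧ φ (i, false) (X - u • Y i) = θ X := fun i =>
        exists_joint (hφ (i, true)) (hφ (i, false)) (hY i)
          (fun ω hω => ((hmem i ω).1 hω).1) (fun ω hω => ((hmem' i ω).1 hω).1)
          (fun ω hω => ((hmem i ω).1 hω).2) (fun ω hω => ((hmem' i ω).1 hω).2) (hYn i)
      choose θ hθ hθ' using hj
      obtain ⟨h, hh, e, he⟩ := L.solve θ hθ Z hZ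
      choose u hu hu' using fun i => hθ' i (Z - h i)
        (sub_mem hZ (Wsp_le_BdS hX m (L.sub h hh i)))
      refine ⟨fun p => h p.1 + u p.1 • Y p.1, ⟨h, hh, u, fun i b => rfl⟩, e, ?_⟩
      rintro ⟨i, b⟩
      simp only
      rw [← sub_sub, ← he i]
      cases b
      · exact hu' i
      · exact hu i
    · intro f hf
      obtain ⟨g, hg, a, rfl⟩ := mem_Wsp_succ.1 hf
      obtain ⟨γ, h, hh, hr⟩ := L.rep g hg
      refine ⟨γ + a * c, fun p => (h + a • k) p.1 + a • Y p.1,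
        ⟨h + a • k, add_mem hh (Submodule.smul_mem _ _ hk), fun _ => a, fun i b => rfl⟩, ?_⟩
      rintro ⟨i, b⟩
      rw [hr i]
      ext ω
      simp [hYdef]
      ring
    · rintro g ⟨h, hh, κ, hg⟩ ⟨i, b⟩
      rw [hg]
      exact add_mem (Wsp_le_succ X m (L.sub h hh i)) (Submodule.smul_mem _ _ (hYW i))

def Av (f : Ω → ℝ) (A : Set Ω) : Prop := (∀ ω ∈ A, 0 ≤ f ω) ∨ (∀ ω ∈ A, f ω ≤ 0)

open Classical in
def ind (p : Prop) : ℝ := if p then 1 else 0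

lemma ind_of {p : Prop} (h : p) : ind p = 1 := if_pos h
lemma ind_nonneg (p : Prop) : 0 ≤ ind p := by unfold ind; split_ifs <;> norm_num

lemma Av.mono {f : Ω → ℝ} {A B : Set Ω} (h : Av f B) (hAB : A ⊆ B) : Av f A :=
  h.imp (fun h ω hω => h ω (hAB hω)) (fun h ω hω => h ω (hAB hω))

lemma Av.neg {f : Ω → ℝ} {A : Set Ω} (h : Av (-f) A) : Av f A := by
  rcases h with h | h
  · exact Or.inr fun ω hω => by simpa using h ω hω
  · exact Or.inl fun ω hω => by simpa using h ω hω

def Good (X : ℕ → Ω → ℝ) (d : ℕ) (α β : ℝ) : Prop :=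
  ∃ N : ℕ, 0 < N ∧ ∀ ν : Measure Ω, IsFiniteMeasure ν → NullH ν X d →
    ∃ (ι : Type) (_ : Fintype ι) (A : ι → Set Ω), Fintype.card ι = N ∧
      (∀ i, MeasurableSet (A i)) ∧ (∀ i, α * ν.real univ ≤ ν.real (A i)) ∧
      ∀ f ∈ Wsp X d, β * N ≤ ∑ i, ind (Av f (A i))

lemma good_zero_case (X : ℕ → Ω → ℝ) (d : ℕ) (α β : ℝ) (hβ : β ≤ 1) (N : ℕ)
    (ν : Measure Ω) (h0 : ν.real univ = 0) :
    ∃ (ι : Type) (_ : Fintype ι) (A : ι → Set Ω), Fintype.card ι = N ∧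
      (∀ i, MeasurableSet (A i)) ∧ (∀ i, α * ν.real univ ≤ ν.real (A i)) ∧
      ∀ f ∈ Wsp X d, β * N ≤ ∑ i, ind (Av f (A i)) := by
  refine ⟨Fin N, inferInstance, fun _ => ∅, by simp, fun _ => MeasurableSet.empty,
    by simp [h0], fun f _ => ?_⟩
  have : Av f (∅ : Set Ω) := Or.inl (by simp)
  have hN : (0:ℝ) ≤ N := by positivity
  simp [ind_of this]
  nlinarith

lemma good_trivial (X : ℕ → Ω → ℝ) (d : ℕ) : Good X d 1 0 := by
  refine ⟨1, one_pos, fun ν _ _ => ⟨Unit, inferInstance, fun _ => univ, by simp,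
    fun _ => MeasurableSet.univ, by simp, fun f _ => ?_⟩⟩
  simpa using ind_nonneg _

lemma good_mul {X : ℕ → Ω → ℝ} {d : ℕ} {α β α' β' : ℝ} (hα' : 0 ≤ α') (hβ' : β' ≤ 1)
    (h : Good X d α β) (h' : Good X d α' β') :
    Good X d (α * α') (1 - (1 - β) * (1 - β')) := by
  obtain ⟨N, hN, H⟩ := h
  obtain ⟨N', hN', H'⟩ := h'
  refine ⟨N * N', Nat.mul_pos hN hN', fun ν hν hnull => ?_⟩
  obtain ⟨ι, _, A, hc, hAm, hA, hf⟩ := H ν hν hnull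
  choose J hJ B hcB hBm hB hfB using fun i => H' (ν.restrict (A i)) inferInstance
    (fun j hj g hg => le_antisymm (le_trans (Measure.restrict_apply_le _ _)
      (hnull j hj g hg).le) (zero_le))
  refine ⟨Σ i, J i, inferInstance, fun p => A p.1 ∩ B p.1 p.2, ?_, ?_, ?_, ?_⟩
  · rw [Fintype.card_sigma]
    simp [hcB, hc]
  · rintro ⟨i, j⟩
    exact (hAm i).inter (hBm i j)
  · rintro ⟨i, j⟩
    have h1 := hB i j
    simp only [measureReal_restrict_apply MeasurableSet.univ,
      measureReal_restrict_apply (hBm i j), univ_inter] at h1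
    rw [inter_comm (B i j)] at h1
    refine le_trans ?_ h1
    have := mul_le_mul_of_nonneg_left (hA i) hα'
    linarith
  · intro f hfW
    rw [Fintype.sum_sigma]
    have key : ∀ i, β' * N' + ind (Av f (A i)) * ((1 - β') * N') ≤
        ∑ j, ind (Av f (A i ∩ B i j)) := by
      intro i
      by_cases hi : Av f (A i)
      · have : ∀ j, ind (Av f (A i ∩ B i j)) = 1 := fun j => ind_of (hi.mono inter_subset_left)
        simp [this, ind_of hi, hcB]
        linarith
      · have h0 : ind (Av f (A i)) = 0 := if_neg hi
        rw [h0, zero_mul, add_zero]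
        refine (hfB i f hfW).trans (Finset.sum_le_sum fun j _ => ?_)
        by_cases hj : Av f (B i j)
        · rw [ind_of hj, ind_of (hj.mono inter_subset_right)]
        · exact le_of_eq_of_le (if_neg hj) (ind_nonneg _)
    refine le_trans ?_ (Finset.sum_le_sum fun i _ => key i)
    rw [Finset.sum_add_distrib, ← Finset.sum_mul]
    have h1 := hf f hfW
    have h2 : 0 ≤ (1 - β') * (N' : ℝ) := mul_nonneg (by linarith) (by positivity)
    have h3 := mul_le_mul_of_nonneg_right h1 h2
    rw [Finset.sum_mul] at h3
    simp only [Finset.sum_const, Finset.card_univ, hc, nsmul_eq_mul]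
    push_cast
    linarith

lemma good_pow {X : ℕ → Ω → ℝ} {d : ℕ} {α β : ℝ} (hα : 0 ≤ α) (hβ : β ≤ 1)
    (h : Good X d α β) (k : ℕ) : Good X d (α ^ k) (1 - (1 - β) ^ k) := by
  induction k with
  | zero => simpa using good_trivial X d
  | succ k ih =>
    have := good_mul hα hβ ih h
    rw [sub_sub_cancel] at this
    rwa [pow_succ, pow_succ]

lemma good_yao {X : ℕ → Ω → ℝ} (hX : ∀ j, X j ∈ BdS Ω) (d : ℕ) :
    Good X d (1 / 2 ^ d) (1 / 2 ^ d) := by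
  refine ⟨2 ^ d, by positivity, fun ν _ hnull => ?_⟩
  have hle : (1:ℝ) / 2 ^ d ≤ 1 := by
    rw [div_le_one (by positivity)]
    exact one_le_pow₀ (by norm_num)
  rcases eq_or_lt_of_le (measureReal_nonneg (μ := ν) (s := univ)) with h0 | h0
  · exact good_zero_case X d _ _ hle _ ν h0.symm
  obtain ⟨ι, _, S, K, hc, L⟩ := lev_exists ν h0 X hX d hnull d le_rfl
  refine ⟨ι, inferInstance, S, hc, L.meas, fun i => ?_, fun f hf => ?_⟩
  · rw [one_div, inv_mul_le_iff₀ (by positivity)]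
    exact L.mass i
  · push_cast
    rw [one_div, inv_mul_cancel₀ (by positivity)]
    obtain ⟨γ, h, hh, hr⟩ := L.rep f hf
    have : ∃ i, Av f (S i) := by
      rcases le_total 0 γ with hγ | hγ
      · obtain ⟨i, hi⟩ := L.pos h hh
        refine ⟨i, Or.inl fun ω hω => ?_⟩
        rw [hr i]
        exact add_nonneg hγ (hi ω hω)
      · obtain ⟨i, hi⟩ := L.pos (-h) (neg_mem hh)
        refine ⟨i, Or.inr fun ω hω => ?_⟩
        rw [hr i]
        have := hi ω hω
        simp only [Pi.neg_apply] at this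
        simp only [Pi.add_apply]
        linarith
    obtain ⟨i, hi⟩ := this
    rw [← ind_of hi]
    exact Finset.single_le_sum (f := fun i => ind (Av f (S i))) (fun _ _ => ind_nonneg _)
      (Finset.mem_univ i)

lemma good_three {X : ℕ → Ω → ℝ} (hX : ∀ j, X j ∈ BdS Ω) (m : ℕ) :
    Good X (m + 1) (1 / (3 * 2 ^ m)) (2 / (3 * 2 ^ m)) := by
  refine ⟨3 * 2 ^ m, by positivity, fun ν _ hnull => ?_⟩
  have hle : (2:ℝ) / (3 * 2 ^ m) ≤ 1 := by
    rw [div_le_one (by positivity)]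
    have : (1:ℝ) ≤ 2 ^ m := one_le_pow₀ (by norm_num)
    linarith
  rcases eq_or_lt_of_le (measureReal_nonneg (μ := ν) (s := univ)) with h0 | h0
  · exact good_zero_case X _ _ _ hle _ ν h0.symm
  obtain ⟨ι, _, S, K, hc, L⟩ := lev_exists ν h0 X hX (m + 1) hnull m (by omega)
  have hSp := L.cell_pos h0
  obtain ⟨k, hk, p, hp⟩ := L.solve (fun i => quant ν (S i) (1/3))
    (fun i => quant_isFn (L.meas i) (hSp i) (by norm_num) (by norm_num)) (X m) (hX m)
  obtain ⟨l, hl, q, hq⟩ := L.solve (fun i => quant ν (S i) (2/3))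
    (fun i => quant_isFn (L.meas i) (hSp i) (by norm_num) (by norm_num)) (X m) (hX m)
  have hXk : ∀ i, X m - k i ∈ BdS Ω := fun i =>
    sub_mem (hX m) (Wsp_le_BdS hX m (L.sub k hk i))
  have hXl : ∀ i, X m - l i ∈ BdS Ω := fun i =>
    sub_mem (hX m) (Wsp_le_BdS hX m (L.sub l hl i))
  have hpq : p ≤ q := by
    obtain ⟨i, hi⟩ := L.pos (k - l) (sub_mem hk hl)
    rw [← hp i, ← hq i]
    have h1 := (quant_isFn (ν := ν) (L.meas i) (hSp i) (l := 1/3) (by norm_num)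
      (by norm_num)).mono _ (hXk i) _ (hXl i) (fun ω hω => by
        have := hi ω hω
        simp only [Pi.sub_apply] at *
        linarith)
    refine h1.trans ?_
    refine quant_le (hSp i) (by norm_num) (hXl i) ?_
    have h2 := quant_mass_le (ν := ν) (l := 2/3) (L.meas i) (hSp i) (by norm_num) (by norm_num)
      (hXl i)
    have := hSp i
    linarith
  let A : ι × Fin 3 → Set Ω := fun x =>
    ![S x.1 ∩ {ω | (X m - k x.1) ω ≤ p},
      S x.1 ∩ {ω | p ≤ (X m - k x.1) ω} ∩ {ω | (X m - l x.1) ω ≤ q},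
      S x.1 ∩ {ω | q ≤ (X m - l x.1) ω}] x.2
  have hA0 : ∀ i, A (i, 0) = S i ∩ {ω | (X m - k i) ω ≤ p} := fun i => rfl
  have hA1 : ∀ i, A (i, 1) = S i ∩ {ω | p ≤ (X m - k i) ω} ∩ {ω | (X m - l i) ω ≤ q} :=
    fun i => rfl
  have hA2 : ∀ i, A (i, 2) = S i ∩ {ω | q ≤ (X m - l i) ω} := fun i => rfl
  refine ⟨ι × Fin 3, inferInstance, A, ?_, ?_, ?_, ?_⟩
  · rw [Fintype.card_prod, hc, Fintype.card_fin, mul_comm]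
  · rintro ⟨i, j⟩
    have h1 := L.meas i
    have h2 := (hXk i).1
    have h3 := (hXl i).1
    fin_cases j
    · exact h1.inter (measurableSet_le h2 measurable_const)
    · exact (h1.inter (measurableSet_le measurable_const h2)).inter
        (measurableSet_le h3 measurable_const)
    · exact h1.inter (measurableSet_le measurable_const h3)
  · rintro ⟨i, j⟩
    have e1 := quant_mass_le (ν := ν) (l := 1/3) (L.meas i) (hSp i) (by norm_num) (by norm_num)
      (hXk i)
    have e2 := quant_mass_lt (ν := ν) (l := 1/3) (L.meas i) (hSp i) (by norm_num) (by norm_num)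
      (hXk i)
    have e3 := quant_mass_le (ν := ν) (l := 2/3) (L.meas i) (hSp i) (by norm_num) (by norm_num)
      (hXl i)
    have e4 := quant_mass_ge (ν := ν) (l := 2/3) (L.meas i) (hSp i) (by norm_num) (by norm_num)
      (hXl i)
    rw [hp i] at e1 e2
    rw [hq i] at e3 e4
    have hm := L.mass i
    suffices h : 1/3 * ν.real (S i) ≤ ν.real (A (i, j)) by
      rw [div_mul_eq_mul_div, one_mul, div_le_iff₀ (by positivity)]
      have h2 : (0:ℝ) < 2 ^ m := by positivity
      nlinarith
    fin_cases j
    · exact e1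
    · have : ν.real (S i ∩ {ω | (X m - l i) ω ≤ q}) ≤
          ν.real (S i ∩ {ω | (X m - k i) ω < p}) + ν.real (A (i, 1)) := by
        refine le_trans (measureReal_mono ?_) (measureReal_union_le _ _)
        rintro ω ⟨hω, hω'⟩
        rcases lt_or_ge ((X m - k i) ω) p with h | h
        · exact Or.inl ⟨hω, h⟩
        · exact Or.inr ⟨⟨hω, h⟩, hω'⟩
      show _ ≤ ν.real (A (i, 1))
      linarith
    · refine le_trans ?_ e4
      linarith
  · intro f hf
    have hN : (2:ℝ) / (3 * 2 ^ m) * ((3 * 2 ^ m : ℕ) : ℝ) = 2 := by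
      push_cast
      field_simp
    rw [hN]
    have two : ∀ x y : ι × Fin 3, x ≠ y → Av f (A x) → Av f (A y) →
        2 ≤ ∑ i, ind (Av f (A i)) := by
      classical
      intro x y hxy hx hy
      calc (2:ℝ) = ∑ i ∈ ({x, y} : Finset (ι × Fin 3)), ind (Av f (A i)) := by
            rw [Finset.sum_pair hxy, ind_of hx, ind_of hy]; norm_num
        _ ≤ _ := Finset.sum_le_sum_of_subset_of_nonneg (Finset.subset_univ _)
            (fun _ _ _ => ind_nonneg _)
    suffices h : ∃ x y : ι × Fin 3, x ≠ y ∧ Av f (A x) ∧ Av f (A y) by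
      obtain ⟨x, y, h1, h2, h3⟩ := h
      exact two x y h1 h2 h3
    clear two hN
    -- main case
    have main : ∀ f ∈ Wsp X (m + 1), ∀ g ∈ Wsp X m, ∀ a : ℝ, 0 ≤ a → f = g + a • X m →
        ∃ x y : ι × Fin 3, x ≠ y ∧ Av f (A x) ∧ Av f (A y) := by
      intro f hf g hg a ha hfe
      obtain ⟨γ, h, hh, hr⟩ := L.rep g hg
      have fk : ∀ i ω, f ω = (γ + a * p) + (h + a • k) i ω + a * ((X m - k i) ω - p) := by
        intro i ω
        rw [hfe, hr i]
        simp only [Pi.add_apply, Pi.smul_apply, smul_eq_mul, Pi.sub_apply]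
        ring
      have fl : ∀ i ω, f ω = (γ + a * q) + (h + a • l) i ω + a * ((X m - l i) ω - q) := by
        intro i ω
        rw [hfe, hr i]
        simp only [Pi.add_apply, Pi.smul_apply, smul_eq_mul, Pi.sub_apply]
        ring
      have hkK : h + a • k ∈ K := add_mem hh (Submodule.smul_mem _ _ hk)
      have hlK : h + a • l ∈ K := add_mem hh (Submodule.smul_mem _ _ hl)
      obtain ⟨i1, hi1⟩ := L.pos _ hkK
      obtain ⟨i2, hi2⟩ := L.pos _ hlK
      obtain ⟨i3, hi3⟩ := L.pos _ (neg_mem hkK)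
      obtain ⟨i4, hi4⟩ := L.pos _ (neg_mem hlK)
      have hPQ : γ + a * p ≤ γ + a * q := by nlinarith
      -- negative left cell
      have cL : γ + a * p ≤ 0 → Av f (A (i3, 0)) := by
        intro hP
        refine Or.inr fun ω hω => ?_
        rw [hA0] at hω
        obtain ⟨h1, h2⟩ := hω
        have h3 := hi3 ω h1
        rw [fk i3 ω]
        simp only [Pi.neg_apply, mem_ofPred_eq] at h2 h3
        nlinarith [mul_nonneg ha (sub_nonneg.2 h2)]
      have cR : 0 ≤ γ + a * q → Av f (A (i2, 2)) := by
        intro hP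
        refine Or.inl fun ω hω => ?_
        rw [hA2] at hω
        obtain ⟨h1, h2⟩ := hω
        have h3 := hi2 ω h1
        rw [fl i2 ω]
        simp only [mem_ofPred_eq] at h2
        nlinarith [mul_nonneg ha (sub_nonneg.2 h2)]
      have cM : 0 ≤ γ + a * p → Av f (A (i1, 1)) := by
        intro hP
        refine Or.inl fun ω hω => ?_
        rw [hA1] at hω
        obtain ⟨⟨h1, h2⟩, -⟩ := hω
        have h3 := hi1 ω h1
        rw [fk i1 ω]
        simp only [mem_ofPred_eq] at h2
        nlinarith [mul_nonneg ha (sub_nonneg.2 h2)]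
      have cM' : γ + a * q ≤ 0 → Av f (A (i4, 1)) := by
        intro hP
        refine Or.inr fun ω hω => ?_
        rw [hA1] at hω
        obtain ⟨⟨h1, -⟩, h2⟩ := hω
        have h3 := hi4 ω h1
        rw [fl i4 ω]
        simp only [Pi.neg_apply, mem_ofPred_eq] at h2 h3
        nlinarith [mul_nonneg ha (sub_nonneg.2 h2)]
      rcases le_total 0 (γ + a * p) with hP | hP
      · exact ⟨(i1, 1), (i2, 2), by simp, cM hP, cR (hP.trans hPQ)⟩
      · rcases le_total 0 (γ + a * q) with hQ | hQ
        · exact ⟨(i3, 0), (i2, 2), by simp, cL hP, cR hQ⟩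
        · exact ⟨(i3, 0), (i4, 1), by simp, cL hP, cM' hQ⟩
    obtain ⟨g, hg, a, hfe⟩ := mem_Wsp_succ.1 hf
    rcases le_total 0 a with ha | ha
    · exact main f hf g hg a ha hfe
    · obtain ⟨x, y, h1, h2, h3⟩ := main (-f) (neg_mem hf) (-g) (neg_mem hg) (-a) (by linarith)
        (by rw [hfe]; module)
      exact ⟨x, y, h1, h2.neg, h3.neg⟩

end Levels

section SphereLemmas

open scoped Pointwise in
lemma hyper_null {d : ℕ} {μ : Measure (Sph d)} (hμ : NiceSphMeasure d μ)
    (b : Fin (d + 1) → ℝ) (i : Fin (d + 1)) (hb : b i ≠ 0) :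
    μ {x : Sph d | ∑ j, b j * (x : EuclideanSpace ℝ (Fin (d + 1))) j = 0} = 0 := by
  obtain ⟨-, f, -, -, rfl⟩ := hμ
  apply withDensity_absolutelyContinuous
  let l : EuclideanSpace ℝ (Fin (d + 1)) →ₗ[ℝ] ℝ :=
    { toFun := fun x => ∑ j, b j * x j
      map_add' := fun x y => by simp [mul_add, Finset.sum_add_distrib]
      map_smul' := fun c x => by simp [Finset.mul_sum, mul_left_comm] }
  have hl : ∀ x, l x = ∑ j, b j * x j := fun x => rfl
  have hlc : Continuous l := LinearMap.continuous_of_finiteDimensional l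
  have hmeas : MeasurableSet {x : Sph d | ∑ j, b j * (x : EuclideanSpace ℝ (Fin (d + 1))) j = 0} :=
    (isClosed_eq (hlc.comp continuous_subtype_val) continuous_const).measurableSet
  rw [sphMeasure, Measure.smul_apply, Measure.toSphere_apply' _ hmeas]
  have h0 : (volume : Measure (EuclideanSpace ℝ (Fin (d + 1)))) (LinearMap.ker l : Set _) = 0 := by
    apply Measure.addHaar_submodule
    intro h
    have : EuclideanSpace.single i (1:ℝ) ∈ LinearMap.ker l := by rw [h]; trivial
    rw [LinearMap.mem_ker, hl] at this
    simp [Pi.single_apply] at this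
    exact hb this
  have h1 : (volume : Measure (EuclideanSpace ℝ (Fin (d + 1)))) (Ioo (0 : ℝ) 1 •
      (Subtype.val '' {x : Sph d | ∑ j, b j * (x : EuclideanSpace ℝ (Fin (d + 1))) j = 0})) = 0 := by
    refine measure_mono_null ?_ h0
    rintro _ ⟨r, -, _, ⟨x, hx, rfl⟩, rfl⟩
    simp only [mem_ofPred_eq, ← hl] at hx
    simp [hx]
  rw [h1]
  simp

lemma limit_sets {d : ℕ} (μ1 μ2 : Measure (Sph d)) [IsProbabilityMeasure μ1]
    [IsProbabilityMeasure μ2] (s α β : ℝ) (hα : 0 < α)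
    (h : ∀ ε > 0, ∃ A B : Set (Sph d), α - ε ≤ μ1.real A ∧ β ≤ μ2.real B ∧
      ∀ a ∈ A, ∀ b ∈ B, 0 ≤ s * inner (𝕜 := ℝ) (a : EuclideanSpace ℝ (Fin (d + 1)))
        (b : EuclideanSpace ℝ (Fin (d + 1)))) :
    ∃ A B : Set (Sph d), α ≤ μ1.real A ∧ β ≤ μ2.real B ∧
      ∀ a ∈ A, ∀ b ∈ B, 0 ≤ s * inner (𝕜 := ℝ) (a : EuclideanSpace ℝ (Fin (d + 1)))
        (b : EuclideanSpace ℝ (Fin (d + 1))) := by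
  have hε : ∀ n : ℕ, 0 < α / ((n : ℝ) + 2) := fun n => by positivity
  choose A B hA hB hAB using fun n : ℕ => h _ (hε n)
  have hne : ∀ n, (A n).Nonempty := by
    intro n
    by_contra h0
    rw [not_nonempty_iff_eq_empty] at h0
    have h1 := hA n
    rw [h0, measureReal_empty] at h1
    have : α / ((n : ℝ) + 2) < α := by
      rw [div_lt_iff₀ (by positivity)]
      nlinarith [(Nat.cast_nonneg n : (0:ℝ) ≤ n)]
    linarith
  let K : ℕ → TopologicalSpace.NonemptyCompacts (Sph d) := fun n =>
    ⟨⟨closure (A n), isClosed_closure.isCompact⟩, (hne n).closure⟩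
  have hK : ∀ n, (K n : Set (Sph d)) = closure (A n) := fun n => rfl
  obtain ⟨L, φ, hφ, hlim⟩ := CompactSpace.tendsto_subseq K
  have hfin : ∀ P Q : TopologicalSpace.NonemptyCompacts (Sph d),
      hausdorffEDist (P : Set (Sph d)) (Q : Set (Sph d)) ≠ ⊤ := fun P Q =>
    hausdorffEDist_ne_top_of_nonempty_of_bounded P.nonempty Q.nonempty
      P.isCompact.isBounded Q.isCompact.isBounded
  have hev : ∀ r > 0, ∀ᶠ n in Filter.atTop,
      hausdorffDist (K (φ n) : Set (Sph d)) (L : Set (Sph d)) < r := by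
    intro r hr
    have := (Metric.tendsto_nhds.1 hlim) r hr
    filter_upwards [this] with n hn
    simpa [NonemptyCompacts.dist_eq] using hn
  have hcont : ∀ b : Sph d, Continuous (fun a : Sph d =>
      s * inner (𝕜 := ℝ) (a : EuclideanSpace ℝ (Fin (d + 1))) (b : EuclideanSpace ℝ (Fin (d + 1)))) :=
    fun b => by fun_prop
  have hcont' : ∀ a : Sph d, Continuous (fun b : Sph d =>
      s * inner (𝕜 := ℝ) (a : EuclideanSpace ℝ (Fin (d + 1))) (b : EuclideanSpace ℝ (Fin (d + 1)))) :=
    fun b => by fun_prop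
  let D : ℕ → Set (Sph d) := fun n => {b | ∀ a ∈ K (φ n), 0 ≤ s * inner (𝕜 := ℝ)
    (a : EuclideanSpace ℝ (Fin (d + 1))) (b : EuclideanSpace ℝ (Fin (d + 1)))}
  have hDc : ∀ n, IsClosed (D n) := by
    intro n
    have : D n = ⋂ a ∈ K (φ n), {b : Sph d | 0 ≤ s * inner (𝕜 := ℝ)
      (a : EuclideanSpace ℝ (Fin (d + 1))) (b : EuclideanSpace ℝ (Fin (d + 1)))} := by
      ext b; simp [D]
    rw [this]
    exact isClosed_biInter fun a _ => isClosed_le continuous_const (hcont' a)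
  have hBD : ∀ n, B (φ n) ⊆ D n := by
    intro n b hb a ha
    have hcl : closure (A (φ n)) ⊆ {a : Sph d | 0 ≤ s * inner (𝕜 := ℝ)
      (a : EuclideanSpace ℝ (Fin (d + 1))) (b : EuclideanSpace ℝ (Fin (d + 1)))} :=
      closure_minimal (fun a ha => hAB _ a ha b hb) (isClosed_le continuous_const (hcont b))
    exact hcl ha
  refine ⟨L, {b | ∀ a ∈ L, 0 ≤ s * inner (𝕜 := ℝ) (a : EuclideanSpace ℝ (Fin (d + 1)))
    (b : EuclideanSpace ℝ (Fin (d + 1)))}, ?_, ?_, fun a ha b hb => hb a ha⟩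
  · have ht := tendsto_measure_cthickening_of_isClosed (μ := μ1) (s := (L : Set (Sph d)))
      ⟨1, one_pos, measure_ne_top _ _⟩ L.isCompact.isClosed
    have ht' := ((ENNReal.tendsto_toReal (measure_ne_top μ1 _)).comp ht).mono_left
      (nhdsWithin_le_nhds (s := Ioi (0:ℝ)))
    refine ge_of_tendsto ht' ?_
    filter_upwards [self_mem_nhdsWithin] with r hr
    have hr : 0 < r := hr
    refine le_of_forall_pos_le_add fun ε hε => ?_
    have h1 : Filter.Tendsto (fun n : ℕ => α / ((φ n : ℝ) + 2)) Filter.atTop (nhds 0) := by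
      apply Filter.Tendsto.const_div_atTop
      apply Filter.tendsto_atTop_add_const_right
      exact tendsto_natCast_atTop_atTop.comp hφ.tendsto_atTop
    obtain ⟨n, hn1, hn2⟩ := ((hev r hr).and (h1.eventually_lt_const hε)).exists
    have hsub : A (φ n) ⊆ cthickening r (L : Set (Sph d)) := by
      intro a ha
      obtain ⟨y, hy, hay⟩ := exists_dist_lt_of_hausdorffDist_lt (x := a)
        (show a ∈ (K (φ n) : Set (Sph d)) from subset_closure ha) hn1 (hfin _ _)
      exact mem_cthickening_of_dist_le a y r _ hy hay.le
    have h2 : μ1.real (A (φ n)) ≤ μ1.real (cthickening r (L : Set (Sph d))) :=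
      measureReal_mono hsub
    have h3 := hA (φ n)
    simp only [Function.comp]
    change α ≤ μ1.real (cthickening r (L : Set (Sph d))) + ε
    linarith
  · have hsub : (⋂ n : ℕ, ⋃ k : ℕ, D (n + k)) ⊆ {b | ∀ a ∈ L, 0 ≤ s * inner (𝕜 := ℝ)
        (a : EuclideanSpace ℝ (Fin (d + 1))) (b : EuclideanSpace ℝ (Fin (d + 1)))} := by
      intro b hb a ha
      by_contra! hneg
      have ho := (isOpen_lt (hcont b) continuous_const).mem_nhds hneg
      obtain ⟨r, hr, hball⟩ := Metric.mem_nhds_iff.1 ho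
      obtain ⟨n, hn⟩ := Filter.eventually_atTop.1 (hev r hr)
      obtain ⟨k, hk⟩ := mem_iUnion.1 (mem_iInter.1 hb n)
      obtain ⟨a', ha', hd⟩ := exists_dist_lt_of_hausdorffDist_lt' (y := a)
        (show a ∈ (L : Set (Sph d)) from ha) (hn (n + k) (by omega)) (hfin _ _)
      have h1 : _ < (0:ℝ) := hball (Metric.mem_ball.2 hd)
      have h2 := hk a' ha'
      linarith
    have ht : Filter.Tendsto (fun n : ℕ => μ2 (⋃ k : ℕ, D (n + k))) Filter.atTop
        (nhds (μ2 (⋂ n : ℕ, ⋃ k : ℕ, D (n + k)))) := by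
      apply tendsto_measure_iInter_atTop
      · intro n
        exact (MeasurableSet.iUnion fun k => (hDc _).measurableSet).nullMeasurableSet
      · intro m n hmn x hx
        obtain ⟨k, hk⟩ := mem_iUnion.1 hx
        refine mem_iUnion.2 ⟨n - m + k, ?_⟩
        have : m + (n - m + k) = n + k := by omega
        rwa [this]
      · exact ⟨0, measure_ne_top _ _⟩
    have ht' := (ENNReal.tendsto_toReal (measure_ne_top μ2 _)).comp ht
    refine le_trans (ge_of_tendsto' ht' fun n => ?_) (measureReal_mono hsub)
    refine (hB (φ n)).trans (measureReal_mono ?_)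
    exact (hBD n).trans (subset_iUnion (fun k => D (n + k)) 0)

lemma approx_sets {d : ℕ} {α β : ℝ} (hα : 0 ≤ α)
    (hG : ∀ X : ℕ → Sph d → ℝ, (∀ j, X j ∈ BdS (Sph d)) → Good X d α β)
    {μ1 μ2 : Measure (Sph d)} (h1 : NiceSphMeasure d μ1) (h2 : NiceSphMeasure d μ2)
    {ε : ℝ} (hε : 0 < ε) :
    ∃ A B : Set (Sph d), α * (1 / 2 - ε) ≤ μ1.real A ∧ β / 2 ≤ μ2.real B ∧
      ((∀ a ∈ A, ∀ b ∈ B, 0 ≤ 1 * inner (𝕜 := ℝ) (a : EuclideanSpace ℝ (Fin (d + 1)))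
        (b : EuclideanSpace ℝ (Fin (d + 1)))) ∨
      (∀ a ∈ A, ∀ b ∈ B, 0 ≤ (-1) * inner (𝕜 := ℝ) (a : EuclideanSpace ℝ (Fin (d + 1)))
        (b : EuclideanSpace ℝ (Fin (d + 1))))) := by
  haveI := h1.1
  haveI := h2.1
  have hcoord : ∀ i : Fin (d + 1), Continuous fun x : Sph d =>
      (x : EuclideanSpace ℝ (Fin (d + 1))) i := fun i => by fun_prop
  -- choose the hemisphere
  have hs : ∃ s : ℝ, s * s = 1 ∧
      1 / 2 ≤ μ1.real {x : Sph d | 0 < s * (x : EuclideanSpace ℝ (Fin (d + 1))) 0} := by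
    by_contra! hcon
    have e1 := hcon 1 (by norm_num)
    have e2 := hcon (-1) (by norm_num)
    have e3 : μ1.real {x : Sph d | ∑ j, (Pi.single 0 1 : Fin (d + 1) → ℝ) j *
        (x : EuclideanSpace ℝ (Fin (d + 1))) j = 0} = 0 := by
      rw [measureReal_def, hyper_null h1 _ 0 (by simp)]
      simp
    have e4 : (1:ℝ) = μ1.real univ := by simp
    have e5 : μ1.real univ ≤ μ1.real {x : Sph d | 0 < 1 * (x : EuclideanSpace ℝ (Fin (d + 1))) 0} +
        μ1.real {x : Sph d | 0 < (-1) * (x : EuclideanSpace ℝ (Fin (d + 1))) 0} +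
        μ1.real {x : Sph d | ∑ j, (Pi.single 0 1 : Fin (d + 1) → ℝ) j *
        (x : EuclideanSpace ℝ (Fin (d + 1))) j = 0} := by
      refine le_trans (measureReal_mono (μ := μ1) ?_) ((measureReal_union_le (μ := μ1)
        ({x : Sph d | 0 < 1 * (x : EuclideanSpace ℝ (Fin (d + 1))) 0} ∪
        {x : Sph d | 0 < (-1) * (x : EuclideanSpace ℝ (Fin (d + 1))) 0})
        {x : Sph d | ∑ j, (Pi.single 0 1 : Fin (d + 1) → ℝ) j *
        (x : EuclideanSpace ℝ (Fin (d + 1))) j = 0}).trans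
        (add_le_add_left (measureReal_union_le _ _) _))
      intro x _
      simp only [mem_union, mem_ofPred_eq]
      rcases lt_trichotomy ((x : EuclideanSpace ℝ (Fin (d + 1))) 0) 0 with h | h | h
      · left; right; linarith
      · right
        simp [Pi.single_apply, h]
      · left; left; linarith
    linarith
  obtain ⟨s, hss, hs⟩ := hs
  have hδ : ∃ δ : ℝ, 0 < δ ∧
      1 / 2 - ε ≤ μ1.real {x : Sph d | δ ≤ s * (x : EuclideanSpace ℝ (Fin (d + 1))) 0} := by
    have ht : Filter.Tendsto (fun n : ℕ => μ1 {x : Sph d | 1 / ((n : ℝ) + 1) ≤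
        s * (x : EuclideanSpace ℝ (Fin (d + 1))) 0}) Filter.atTop
        (nhds (μ1 (⋃ n : ℕ, {x : Sph d | 1 / ((n : ℝ) + 1) ≤
        s * (x : EuclideanSpace ℝ (Fin (d + 1))) 0}))) := by
      apply tendsto_measure_iUnion_atTop
      intro a b hab x hx
      simp only [mem_ofPred_eq] at hx ⊢
      refine le_trans ?_ hx
      apply one_div_le_one_div_of_le (by positivity)
      have : (a : ℝ) ≤ b := by exact_mod_cast hab
      linarith
    have he : (⋃ n : ℕ, {x : Sph d | 1 / ((n : ℝ) + 1) ≤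
        s * (x : EuclideanSpace ℝ (Fin (d + 1))) 0}) =
        {x : Sph d | 0 < s * (x : EuclideanSpace ℝ (Fin (d + 1))) 0} := by
      ext x
      simp only [mem_iUnion, mem_ofPred_eq]
      constructor
      · rintro ⟨n, hn⟩
        exact lt_of_lt_of_le (by positivity) hn
      · intro hx
        obtain ⟨n, hn⟩ := exists_nat_one_div_lt hx
        exact ⟨n, hn.le⟩
    rw [he] at ht
    have ht' := (ENNReal.tendsto_toReal (measure_ne_top μ1 _)).comp ht
    have hlt : 1 / 2 - ε < (μ1 {x : Sph d | 0 < s *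
        (x : EuclideanSpace ℝ (Fin (d + 1))) 0}).toReal := by
      have : 1 / 2 ≤ (μ1 {x : Sph d | 0 < s *
        (x : EuclideanSpace ℝ (Fin (d + 1))) 0}).toReal := hs
      linarith
    obtain ⟨n, hn⟩ := (ht'.eventually_const_lt hlt).exists
    exact ⟨1 / ((n : ℝ) + 1), by positivity, le_of_lt hn⟩
  obtain ⟨δ, hδ, hH⟩ := hδ
  set H : Set (Sph d) := {x : Sph d | δ ≤ s * (x : EuclideanSpace ℝ (Fin (d + 1))) 0} with hHdef
  have hHm : MeasurableSet H :=
    (isClosed_le continuous_const (continuous_const.mul (hcoord 0))).measurableSet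
  let X : ℕ → Sph d → ℝ := fun j x => if h : j + 1 < d + 1 then
    (x : EuclideanSpace ℝ (Fin (d + 1))) ⟨j + 1, h⟩ /
      max (s * (x : EuclideanSpace ℝ (Fin (d + 1))) 0) δ else 0
  have hXH : ∀ j (hj : j + 1 < d + 1), ∀ x ∈ H,
      X j x * (s * (x : EuclideanSpace ℝ (Fin (d + 1))) 0) =
        (x : EuclideanSpace ℝ (Fin (d + 1))) ⟨j + 1, hj⟩ := by
    intro j hj x hx
    simp only [hHdef, mem_ofPred_eq] at hx
    simp only [X, dif_pos hj, max_eq_left hx]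
    exact div_mul_cancel₀ _ (by linarith)
  have hXB : ∀ j, X j ∈ BdS (Sph d) := by
    intro j
    by_cases hj : j + 1 < d + 1
    · refine ⟨?_, 1 / δ, fun x => ?_⟩
      · simp only [X, dif_pos hj]
        exact (hcoord _).measurable.div
          (((continuous_const.mul (hcoord 0)).max continuous_const).measurable)
      · simp only [X, dif_pos hj, abs_div]
        have hmax : δ ≤ |max (s * (x : EuclideanSpace ℝ (Fin (d + 1))) 0) δ| :=
          (le_max_right _ _).trans (le_abs_self _)
        have hx1 : |(x : EuclideanSpace ℝ (Fin (d + 1))) ⟨j + 1, hj⟩| ≤ 1 := by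
          have h3 := PiLp.norm_apply_le (x : EuclideanSpace ℝ (Fin (d + 1))) ⟨j + 1, hj⟩
          have h4 : ‖(x : EuclideanSpace ℝ (Fin (d + 1)))‖ = 1 := by simp
          rw [h4] at h3
          simpa using h3
        exact div_le_div₀ zero_le_one hx1 hδ hmax
    · have : X j = 0 := by
        ext x
        simp only [X, dif_neg hj, Pi.zero_apply]
      rw [this]
      exact zero_mem _
  have hW : ∀ j ≤ d, ∀ f ∈ Wsp X j, ∃ b : Fin (d + 1) → ℝ, (∀ i : Fin (d + 1), j < i.val → b i = 0) ∧
      ∀ x ∈ H, f x * (s * (x : EuclideanSpace ℝ (Fin (d + 1))) 0) =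
        ∑ i, b i * (x : EuclideanSpace ℝ (Fin (d + 1))) i := by
    intro j
    induction j with
    | zero =>
      intro _ f hf
      obtain ⟨a, rfl⟩ := mem_Wsp_zero.1 hf
      refine ⟨Pi.single 0 (a * s), fun i hi => ?_, fun x _ => ?_⟩
      · have : i ≠ 0 := by rintro rfl; simp at hi
        simp [Pi.single_apply, this]
      · simp [Pi.single_apply, mul_assoc]
    | succ j ih =>
      intro hj f hf
      obtain ⟨g, hg, a, rfl⟩ := mem_Wsp_succ.1 hf
      obtain ⟨b, hb, hbx⟩ := ih (by omega) g hg
      refine ⟨b + Pi.single ⟨j + 1, by omega⟩ a, fun i hi => ?_, fun x hx => ?_⟩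
      · have : i ≠ ⟨j + 1, by omega⟩ := by
          intro h
          have h' := congrArg Fin.val h
          simp at h'
          omega
        simp [Pi.single_apply, this, hb i (by omega)]
      · have e := hXH j (by omega) x hx
        simp only [Pi.add_apply, Pi.smul_apply, smul_eq_mul, add_mul, Finset.sum_add_distrib]
        rw [hbx x hx, mul_assoc, e]
        simp [Pi.single_apply]
  have hW' : ∀ b : Fin (d + 1) → ℝ, ∃ f ∈ Wsp X d, ∀ x ∈ H,
      f x * (s * (x : EuclideanSpace ℝ (Fin (d + 1))) 0) =
        ∑ i, b i * (x : EuclideanSpace ℝ (Fin (d + 1))) i := by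
    intro b
    have hmono : Monotone (Wsp X) := monotone_nat_of_le_succ (Wsp_le_succ X)
    refine ⟨(fun _ => s * b 0) + ∑ j : Fin d, b j.succ • X j, add_mem (const_mem_Wsp X d _)
      (sum_mem fun j _ => Submodule.smul_mem _ _ (hmono (Nat.succ_le_of_lt j.2)
        (self_mem_Wsp X j))), fun x hx => ?_⟩
    rw [Fin.sum_univ_succ]
    simp only [Pi.add_apply, Finset.sum_apply, Pi.smul_apply, smul_eq_mul, add_mul, Finset.sum_mul]
    congr 1
    · calc _ = (s * s) * (b 0 * (x : EuclideanSpace ℝ (Fin (d + 1))) 0) := by ring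
        _ = _ := by rw [hss, one_mul]
    · refine Finset.sum_congr rfl fun j _ => ?_
      rw [mul_assoc, hXH j (by omega) x hx]
      rfl
  obtain ⟨N, hN, HG⟩ := hG X hXB
  have hnull : NullH (μ1.restrict H) X d := by
    intro j hj g hg
    obtain ⟨b, hb, hbx⟩ := hW j hj.le g hg
    rw [Measure.restrict_apply' hHm]
    refine measure_mono_null ?_ (hyper_null h1 (Pi.single ⟨j + 1, by omega⟩ 1 - b)
      ⟨j + 1, by omega⟩ (by simp [hb ⟨j + 1, by omega⟩ (by simp)]))
    rintro x ⟨hx, hxH⟩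
    simp only [mem_ofPred_eq] at hx ⊢
    have e1 := hbx x hxH
    have e2 := hXH j (by omega) x hxH
    simp only [Pi.sub_apply, sub_mul, Finset.sum_sub_distrib]
    rw [← e1, ← hx, e2]
    simp [Pi.single_apply]
  obtain ⟨ι, _, A, hc, hAm, hA, hAv⟩ := HG (μ1.restrict H) inferInstance hnull
  have hA' : ∀ i, α * (1 / 2 - ε) ≤ μ1.real (A i ∩ H) := by
    intro i
    have h3 := hA i
    rw [measureReal_restrict_apply (hAm i), measureReal_restrict_apply MeasurableSet.univ,
      univ_inter] at h3
    exact (mul_le_mul_of_nonneg_left hH hα).trans h3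
  let P : ℝ → ι → Set (Sph d) := fun t i => {b | ∀ a ∈ A i ∩ H, 0 ≤ t * inner (𝕜 := ℝ)
    (a : EuclideanSpace ℝ (Fin (d + 1))) (b : EuclideanSpace ℝ (Fin (d + 1)))}
  have hPc : ∀ t i, MeasurableSet (P t i) := by
    intro t i
    have : P t i = ⋂ a ∈ A i ∩ H, {b : Sph d | 0 ≤ t * inner (𝕜 := ℝ)
      (a : EuclideanSpace ℝ (Fin (d + 1))) (b : EuclideanSpace ℝ (Fin (d + 1)))} := by
      ext b; simp [P]
    rw [this]
    exact (isClosed_biInter fun a _ => isClosed_le continuous_const (by fun_prop)).measurableSet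
  have hPm : ∀ i, MeasurableSet (P 1 i ∪ P (-1) i) := fun i => (hPc _ _).union (hPc _ _)
  have hbig : β * N ≤ ∑ i, μ2.real (P 1 i ∪ P (-1) i) := by
    have hIntegr : ∀ i, Integrable ((P 1 i ∪ P (-1) i).indicator (1 : Sph d → ℝ)) μ2 := fun i =>
      (integrable_const (1:ℝ)).indicator (hPm i)
    have e1 : ∑ i, μ2.real (P 1 i ∪ P (-1) i) =
        ∫ b, ∑ i, (P 1 i ∪ P (-1) i).indicator (1 : Sph d → ℝ) b ∂μ2 := by
      rw [integral_finsetSum _ fun i _ => hIntegr i]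
      exact Finset.sum_congr rfl fun i _ => (integral_indicator_one (hPm i)).symm
    have e2 : β * N = ∫ _b : Sph d, β * (N : ℝ) ∂μ2 := by simp
    rw [e1, e2]
    refine integral_mono (integrable_const _) (integrable_finsetSum _ fun i _ => hIntegr i) ?_
    intro b
    obtain ⟨f, hf, hfx⟩ := hW' (fun i => (b : EuclideanSpace ℝ (Fin (d + 1))) i)
    refine (hAv f hf).trans (Finset.sum_le_sum fun i _ => ?_)
    have hin : ∀ a ∈ H, inner (𝕜 := ℝ) (a : EuclideanSpace ℝ (Fin (d + 1)))
        (b : EuclideanSpace ℝ (Fin (d + 1))) =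
        f a * (s * (a : EuclideanSpace ℝ (Fin (d + 1))) 0) := by
      intro a ha
      rw [hfx a ha, PiLp.inner_apply]
      simp
    by_cases hi : Av f (A i)
    · have hbm : b ∈ P 1 i ∪ P (-1) i := by
        rcases hi with hi | hi
        · refine Or.inl fun a ha => ?_
          rw [hin a ha.2, one_mul]
          have h4 : δ ≤ s * (a : EuclideanSpace ℝ (Fin (d + 1))) 0 := ha.2
          exact mul_nonneg (hi a ha.1) (by linarith)
        · refine Or.inr fun a ha => ?_
          rw [hin a ha.2]
          have h4 : δ ≤ s * (a : EuclideanSpace ℝ (Fin (d + 1))) 0 := ha.2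
          nlinarith [hi a ha.1]
      rw [ind_of hi, indicator_of_mem hbm]
      rfl
    · refine le_of_eq_of_le (if_neg hi) (indicator_nonneg (fun _ _ => zero_le_one) _)
  have hex : ∃ i, β / 2 ≤ μ2.real (P 1 i) ∨ β / 2 ≤ μ2.real (P (-1) i) := by
    by_contra! hcon
    haveI : Nonempty ι := Fintype.card_pos_iff.1 (by omega)
    have : ∑ i, μ2.real (P 1 i ∪ P (-1) i) < ∑ _i : ι, β :=
      Finset.sum_lt_sum_of_nonempty Finset.univ_nonempty fun i _ => by
        have h5 := measureReal_union_le (μ := μ2) (P 1 i) (P (-1) i)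
        linarith [(hcon i).1, (hcon i).2]
    simp only [Finset.sum_const, Finset.card_univ, hc, nsmul_eq_mul] at this
    linarith
  obtain ⟨i, hi | hi⟩ := hex
  · exact ⟨A i ∩ H, P 1 i, hA' i, hi, Or.inl fun a ha b hb => hb a ha⟩
  · exact ⟨A i ∩ H, P (-1) i, hA' i, hi, Or.inr fun a ha b hb => hb a ha⟩

lemma mem_CSet_of_good {d : ℕ} {α β : ℝ} (hα : 0 < α) (hβ : 0 ≤ β)
    (hG : ∀ X : ℕ → Sph d → ℝ, (∀ j, X j ∈ BdS (Sph d)) → Good X d α β) :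
    ((1 / 2 * α, 1 / 2 * β) : ℝ × ℝ) ∈ CSet d := by
  refine ⟨by positivity, by positivity, fun μ1 μ2 h1 h2 => ?_⟩
  haveI := h1.1
  haveI := h2.1
  let Q : ℝ → ℝ → Prop := fun s ε => ∃ A B : Set (Sph d), 1 / 2 * α - ε ≤ μ1.real A ∧
    1 / 2 * β ≤ μ2.real B ∧
      ∀ a ∈ A, ∀ b ∈ B, 0 ≤ s * inner (𝕜 := ℝ) (a : EuclideanSpace ℝ (Fin (d + 1)))
        (b : EuclideanSpace ℝ (Fin (d + 1)))
  have hQmono : ∀ s ε ε', ε ≤ ε' → Q s ε → Q s ε' := by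
    rintro s ε ε' hle ⟨A, B, hA, hB⟩
    exact ⟨A, B, by linarith, hB⟩
  have hQ : ∀ ε > 0, Q 1 ε ∨ Q (-1) ε := by
    intro ε hε
    obtain ⟨A, B, hA, hB, h⟩ := approx_sets hα.le hG h1 h2 (div_pos hε hα)
    have hA' : 1 / 2 * α - ε ≤ μ1.real A := by
      refine le_trans (le_of_eq ?_) hA
      field_simp
    exact h.imp (fun h => ⟨A, B, hA', by linarith, h⟩) (fun h => ⟨A, B, hA', by linarith, h⟩)
  have hall : (∀ ε > 0, Q 1 ε) ∨ (∀ ε > 0, Q (-1) ε) := by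
    by_contra! hcon
    obtain ⟨⟨ε, hε, hn⟩, ⟨ε', hε', hn'⟩⟩ := hcon
    rcases hQ (min ε ε') (lt_min hε hε') with h | h
    · exact hn (hQmono _ _ _ (min_le_left _ _) h)
    · exact hn' (hQmono _ _ _ (min_le_right _ _) h)
  have hconv : ∀ (μ : Measure (Sph d)) [IsProbabilityMeasure μ] (t : ℝ) (A : Set (Sph d)),
      t ≤ μ.real A → ENNReal.ofReal t ≤ μ A := by
    intro μ _ t A h
    rw [← ofReal_measureReal (μ := μ) (s := A)]
    exact ENNReal.ofReal_le_ofReal h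
  rcases hall with h | h
  · obtain ⟨A, B, hA, hB, hAB⟩ := limit_sets μ1 μ2 1 _ _ (by positivity) h
    exact ⟨A, B, hconv μ1 _ _ hA, hconv μ2 _ _ hB, Or.inl fun a ha b hb => by
      simpa using hAB a ha b hb⟩
  · obtain ⟨A, B, hA, hB, hAB⟩ := limit_sets μ1 μ2 (-1) _ _ (by positivity) h
    exact ⟨A, B, hconv μ1 _ _ hA, hconv μ2 _ _ hB, Or.inr fun a ha b hb => by
      simpa using hAB a ha b hb⟩

lemma iterated_aux (d : ℕ) (hd : 2 ≤ d) (k₁ k₂ : ℕ) :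
    ((1 / 2 : ℝ) * (1 / 2 ^ d) ^ k₁ * (1 / (3 * 2 ^ (d - 1))) ^ k₂,
      (1 / 2 : ℝ) * (1 - (1 - 1 / 2 ^ d) ^ k₁ * (1 - 1 / (3 * 2 ^ (d - 2))) ^ k₂)) ∈ CSet d := by
  obtain ⟨m, rfl⟩ : ∃ m, d = m + 2 := ⟨d - 2, by omega⟩
  have e1 : m + 2 - 1 = m + 1 := by omega
  have e2 : m + 2 - 2 = m := by omega
  rw [e1, e2, mul_assoc]
  have hp : (1:ℝ) ≤ 2 ^ m := one_le_pow₀ (by norm_num)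
  have hb : (1:ℝ) / 2 ^ (m + 2) ≤ 1 := by
    rw [div_le_one (by positivity)]
    exact one_le_pow₀ (by norm_num)
  have hc : (1:ℝ) / (3 * 2 ^ m) ≤ 1 := by
    rw [div_le_one (by positivity)]
    linarith
  have hb0 : (0:ℝ) < 1 / 2 ^ (m + 2) := by positivity
  have hc0 : (0:ℝ) < 1 / (3 * 2 ^ m) := by positivity
  apply mem_CSet_of_good
  · positivity
  · have := mul_le_one₀ (pow_le_one₀ (n := k₁) (sub_nonneg.2 hb) (by linarith))
      (pow_nonneg (sub_nonneg.2 hc) k₂) (pow_le_one₀ (n := k₂) (sub_nonneg.2 hc) (by linarith))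
    linarith
  · intro X hX
    have g1 := good_pow (by positivity) hb (good_yao hX (m + 2)) k₁
    have g2 := good_three hX (m + 1)
    have e3 : (2:ℝ) / (3 * 2 ^ (m + 1)) = 1 / (3 * 2 ^ m) := by
      rw [pow_succ]; field_simp
    rw [e3] at g2
    have g3 := good_pow (by positivity) hc g2 k₂
    have g4 := good_mul (by positivity) (by linarith [pow_nonneg (sub_nonneg.2 hc) k₂]) g1 g3
    rwa [sub_sub_cancel, sub_sub_cancel] at g4

end SphereLemmas


/-- Pairs in C_d obtained from iterated Yao–Yao partitions: for non-negative integers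
k₁, k₂ not both zero the stated pair belongs to C_d; in particular
(1/2^(d+1), 1/2^(d+1)) ∈ C_d and (1/(3·2^d), 1/(3·2^(d-1))) ∈ C_d. -/
theorem iterated_pairs (d : ℕ) (hd : 2 ≤ d) (k₁ k₂ : ℕ) (hk : ¬(k₁ = 0 ∧ k₂ = 0)) :
    ((1 / 2 : ℝ) * (1 / 2 ^ d) ^ k₁ * (1 / (3 * 2 ^ (d - 1))) ^ k₂,
      (1 / 2 : ℝ) * (1 - (1 - 1 / 2 ^ d) ^ k₁ * (1 - 1 / (3 * 2 ^ (d - 2))) ^ k₂)) ∈ CSet d ∧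
    ((1 / 2 ^ (d + 1) : ℝ), (1 / 2 ^ (d + 1) : ℝ)) ∈ CSet d ∧
    ((1 / (3 * 2 ^ d) : ℝ), (1 / (3 * 2 ^ (d - 1)) : ℝ)) ∈ CSet d := by
  refine ⟨iterated_aux d hd k₁ k₂, ?_, ?_⟩
  · have h := iterated_aux d hd 1 0
    convert h using 2
    · rw [pow_succ]; field_simp
    · rw [pow_succ]; field_simp; ring
  · have h := iterated_aux d hd 0 1
    obtain ⟨m, rfl⟩ : ∃ m, d = m + 2 := ⟨d - 2, by omega⟩
    have e1 : m + 2 - 1 = m + 1 := by omega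
    have e2 : m + 2 - 2 = m := by omega
    rw [e1, e2] at h
    rw [e1]
    convert h using 2
    · rw [pow_succ]; field_simp
    · rw [pow_succ]; field_simp; ring
end
end

section
/- Let d ≥ 2, Δ > 0, 0 < λ ≤ 1, set R = min((1−λ)/Δ, π/2), and let r satisfy 0 < r ≤ R/4 and 2·arcsin(sin r / sin(R − r)) ≤ π/2. Then the pair ( λ·h_d(r) , h_{d−1}(π/2 − 2·arcsin(sin r / sin(R − r))) ) belongs to C_d(Δ); that is, for every probability measure μ1 on S^d whose density with respect to σ_d is a function f that is Lipschitz with constant at most Δ for the geodesic distance on S^d, and every nice measure μ2 on S^d, there exist sets A, B ⊆ S^d with μ1(A) ≥ λ·h_d(r) and μ2(B) ≥ h_{d−1}(π/2 − 2·arcsin(sin r / sin(R − r))) such that either a·b ≥ 0 for all a ∈ A, b ∈ B, or a·b ≤ 0 for all a ∈ A, b ∈ B. -/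
open MeasureTheory Set Metric
open scoped ENNReal
noncomputable section

lemma aux_deriv (y : ℝ) (h0 : -1 < y) (h1 : y < 1) :
    HasDerivAt (fun y => (Real.arcsin y + y * √(1 - y^2)) / 2) (√(1 - y^2)) y := by
  have hpos : 0 < 1 - y^2 := by nlinarith
  have h2 : HasDerivAt (fun y : ℝ => 1 - y^2) (-(2*y)) y := by
    simpa using ((hasDerivAt_id y).pow 2).const_sub 1
  have h3 := h2.sqrt hpos.ne'
  have h4 := (((Real.hasDerivAt_arcsin (by linarith) (by linarith)).add
    ((hasDerivAt_id y).mul h3)).div_const 2)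
  refine h4.congr_deriv ?_
  have hs : 0 < √(1 - y^2) := Real.sqrt_pos.2 hpos
  have hs2 : √(1 - y^2)^2 = 1 - y^2 := Real.sq_sqrt hpos.le
  simp only [id]
  field_simp
  linarith

lemma aux_int (a b : ℝ) (h0 : -1 < a) (hab : a ≤ b) (h1 : b < 1) :
    ∫ y in a..b, √(1 - y^2) = (Real.arcsin b + b * √(1 - b^2)) / 2
      - (Real.arcsin a + a * √(1 - a^2)) / 2 := by
  apply intervalIntegral.integral_eq_sub_of_hasDerivAt (f := fun y => (Real.arcsin y + y * √(1 - y^2)) / 2)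
  · intro y hy
    rw [uIcc_of_le hab] at hy
    exact aux_deriv y (by linarith [hy.1]) (by linarith [hy.2])
  · apply Continuous.intervalIntegrable
    fun_prop

lemma aux_area (θ : ℝ) (h0 : 0 < θ) (h1 : θ < Real.pi / 4) :
    ∫ y in (0:ℝ)..1, (min (Real.sin θ) (√(1 - y^2)) - min (Real.tan (2*θ) * y) (√(1 - y^2))) ≤ 0 := by
  have hpi := Real.pi_pos
  have hsin : 0 < Real.sin θ := Real.sin_pos_of_pos_of_lt_pi h0 (by linarith)
  have hcos : 0 < Real.cos θ := Real.cos_pos_of_mem_Ioo ⟨by linarith, by linarith⟩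
  have hsin2 : 0 < Real.sin (2*θ) := Real.sin_pos_of_pos_of_lt_pi (by linarith) (by linarith)
  have hcos2 : 0 < Real.cos (2*θ) := Real.cos_pos_of_mem_Ioo ⟨by linarith, by linarith⟩
  have hlt : Real.cos (2*θ) < Real.cos θ :=
    Real.cos_lt_cos_of_nonneg_of_le_pi h0.le (by linarith) (by linarith)
  have hlt1 : Real.cos θ < 1 := by
    have := Real.cos_lt_cos_of_nonneg_of_le_pi le_rfl (by linarith) h0
    simpa using this
  have hT : Real.tan (2*θ) * Real.cos (2*θ) = Real.sin (2*θ) := Real.tan_mul_cos hcos2.ne'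
  have hTpos : 0 < Real.tan (2*θ) := by rw [Real.tan_eq_sin_div_cos]; positivity
  have hc : Continuous (fun y : ℝ => min (Real.sin θ) (√(1 - y^2)) - min (Real.tan (2*θ) * y) (√(1 - y^2))) := by
    fun_prop
  have p1 := Real.sin_sq_add_cos_sq θ
  have p2 := Real.sin_sq_add_cos_sq (2*θ)
  rw [← intervalIntegral.integral_add_adjacent_intervals (b := Real.cos (2*θ)) (hc.intervalIntegrable _ _) (hc.intervalIntegrable _ _),
    ← intervalIntegral.integral_add_adjacent_intervals (a := Real.cos (2*θ)) (b := Real.cos θ) (hc.intervalIntegrable _ _) (hc.intervalIntegrable _ _)]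
  have e1 : ∫ y in (0:ℝ)..Real.cos (2*θ), (min (Real.sin θ) (√(1 - y^2)) - min (Real.tan (2*θ) * y) (√(1 - y^2)))
      = ∫ y in (0:ℝ)..Real.cos (2*θ), (Real.sin θ - Real.tan (2*θ) * y) := by
    apply intervalIntegral.integral_congr
    intro y hy
    rw [uIcc_of_le hcos2.le] at hy
    obtain ⟨ha, hb⟩ := hy
    dsimp only
    rw [min_eq_left, min_eq_left]
    · apply Real.le_sqrt_of_sq_le
      have : Real.tan (2*θ) * y ≤ Real.sin (2*θ) := by rw [← hT]; gcongr
      have : (Real.tan (2*θ) * y)^2 ≤ Real.sin (2*θ)^2 := by gcongr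
      nlinarith
    · apply Real.le_sqrt_of_sq_le
      nlinarith
  have e2 : ∫ y in Real.cos (2*θ)..Real.cos θ, (min (Real.sin θ) (√(1 - y^2)) - min (Real.tan (2*θ) * y) (√(1 - y^2)))
      = ∫ y in Real.cos (2*θ)..Real.cos θ, (Real.sin θ - √(1 - y^2)) := by
    apply intervalIntegral.integral_congr
    intro y hy
    rw [uIcc_of_le hlt.le] at hy
    obtain ⟨ha, hb⟩ := hy
    dsimp only
    rw [min_eq_left, min_eq_right]
    · have : Real.sin (2*θ) ≤ Real.tan (2*θ) * y := by rw [← hT]; gcongr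
      refine le_trans ?_ this
      apply Real.sqrt_le_iff.2 ⟨hsin2.le, by nlinarith⟩
    · apply Real.le_sqrt_of_sq_le
      nlinarith
  have e3 : ∫ y in Real.cos θ..1, (min (Real.sin θ) (√(1 - y^2)) - min (Real.tan (2*θ) * y) (√(1 - y^2)))
      = ∫ y in Real.cos θ..1, (0:ℝ) := by
    apply intervalIntegral.integral_congr
    intro y hy
    rw [uIcc_of_le hlt1.le] at hy
    obtain ⟨ha, hb⟩ := hy
    dsimp only
    rw [min_eq_right, min_eq_right, sub_self]
    · have : Real.sin (2*θ) ≤ Real.tan (2*θ) * y := by rw [← hT]; gcongr; linarith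
      refine le_trans ?_ this
      apply Real.sqrt_le_iff.2 ⟨hsin2.le, by nlinarith⟩
    · apply Real.sqrt_le_iff.2 ⟨hsin.le, by nlinarith⟩
  rw [e1, e2, e3, intervalIntegral.integral_sub (by apply Continuous.intervalIntegrable; fun_prop) (by apply Continuous.intervalIntegrable; fun_prop),
   intervalIntegral.integral_sub (by apply Continuous.intervalIntegrable; fun_prop) (by apply Continuous.intervalIntegrable; fun_prop),
   aux_int _ _ (by linarith) hlt.le hlt1]
  have s1 : √(1 - Real.cos θ ^2) = Real.sin θ := by
    rw [← Real.sin_sq, Real.sqrt_sq hsin.le]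
  have s2 : √(1 - Real.cos (2*θ) ^2) = Real.sin (2*θ) := by
    rw [← Real.sin_sq, Real.sqrt_sq hsin2.le]
  have a1 : Real.arcsin (Real.cos θ) = Real.pi/2 - θ := by
    rw [← Real.sin_pi_div_two_sub, Real.arcsin_sin (by linarith) (by linarith)]
  have a2 : Real.arcsin (Real.cos (2*θ)) = Real.pi/2 - 2*θ := by
    rw [← Real.sin_pi_div_two_sub, Real.arcsin_sin (by linarith) (by linarith)]
  rw [s1, s2, a1, a2]
  rw [intervalIntegral.integral_const_mul, integral_id]
  simp only [intervalIntegral.integral_const, smul_eq_mul]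
  have key : Real.tan (2*θ) * ((Real.cos (2*θ)^2 - 0^2)/2) = Real.sin (2*θ) * Real.cos (2*θ) / 2 := by
    rw [← hT]; ring
  rw [key]
  have : Real.sin θ * Real.cos θ ≤ θ := by
    have := Real.sin_le h0.le
    nlinarith
  linarith

lemma aux_weighted (θ : ℝ) (k : ℕ) (h0 : 0 < θ) (h1 : θ < Real.pi / 4) :
    ∫ y in Ioi (0:ℝ), y^k • (min (Real.sin θ) (√(1 - y^2)) - min (Real.tan (2*θ) * y) (√(1 - y^2))) ≤ 0 := by
  have hpi := Real.pi_pos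
  have hsin : 0 < Real.sin θ := Real.sin_pos_of_pos_of_lt_pi h0 (by linarith)
  have hsin2 : 0 < Real.sin (2*θ) := Real.sin_pos_of_pos_of_lt_pi (by linarith) (by linarith)
  have hcos2 : 0 < Real.cos (2*θ) := Real.cos_pos_of_mem_Ioo ⟨by linarith, by linarith⟩
  have hTpos : 0 < Real.tan (2*θ) := by rw [Real.tan_eq_sin_div_cos]; positivity
  have e : ∫ y in Ioi (0:ℝ), y^k • (min (Real.sin θ) (√(1 - y^2)) - min (Real.tan (2*θ) * y) (√(1 - y^2)))
     = ∫ y in Ioc (0:ℝ) 1, y^k • (min (Real.sin θ) (√(1 - y^2)) - min (Real.tan (2*θ) * y) (√(1 - y^2))) := by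
    apply setIntegral_eq_of_subset_of_forall_sdiff_eq_zero measurableSet_Ioi Ioc_subset_Ioi_self
    intro y hy
    have hy0 : 0 < y := hy.1
    have hy1 : 1 < y := by
      by_contra h
      exact hy.2 ⟨hy0, not_lt.1 h⟩
    rw [Real.sqrt_eq_zero_of_nonpos (by nlinarith), min_eq_right hsin.le, min_eq_right (by positivity)]
    simp
  rw [e, ← intervalIntegral.integral_of_le zero_le_one]
  calc _ ≤ ∫ y in (0:ℝ)..1, (Real.sin θ / Real.tan (2*θ))^k * (min (Real.sin θ) (√(1 - y^2)) - min (Real.tan (2*θ) * y) (√(1 - y^2))) := by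
        apply intervalIntegral.integral_mono_on zero_le_one
        · apply Continuous.intervalIntegrable; fun_prop
        · apply Continuous.intervalIntegrable; fun_prop
        · intro y hy
          rw [smul_eq_mul]
          rcases le_total y (Real.sin θ / Real.tan (2*θ)) with h | h
          · have : Real.tan (2*θ) * y ≤ Real.sin θ := by rw [le_div_iff₀ hTpos] at h; linarith
            have h3 : 0 ≤ min (Real.sin θ) (√(1 - y^2)) - min (Real.tan (2*θ) * y) (√(1 - y^2)) := by
              rw [sub_nonneg]; exact min_le_min_right _ this
            have := hy.1
            gcongr
          · have : Real.sin θ ≤ Real.tan (2*θ) * y := by rw [div_le_iff₀ hTpos] at h; linarith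
            have h3 : min (Real.sin θ) (√(1 - y^2)) - min (Real.tan (2*θ) * y) (√(1 - y^2)) ≤ 0 := by
              rw [sub_nonpos]; exact min_le_min_right _ this
            apply mul_le_mul_of_nonpos_right _ h3
            gcongr
    _ ≤ 0 := by
        rw [intervalIntegral.integral_const_mul]
        exact mul_nonpos_of_nonneg_of_nonpos (by positivity) (aux_area θ h0 h1)

/-- diameter of the section -/
lemma aux_section (a c κ ρ x₁ x₂ : ℝ) (hac : a^2 + c^2 = 1) (hρ : 0 < ρ)
    (h1 : ρ^2 ≤ κ - x₁^2) (h2 : ρ^2 ≤ κ - x₂^2)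
    (hb1 : |a * √(κ - x₁^2) + c * x₁| < ρ) (hb2 : |a * √(κ - x₂^2) + c * x₂| < ρ) :
    |x₁ - x₂| ≤ 2 * ρ := by
  have key : ∀ x, ρ^2 ≤ κ - x^2 → |a * √(κ - x^2) + c * x| < ρ →
      c * (-c * √(κ - x^2) + a * x) < 0 := by
    intro x h hb
    have ht : ρ ≤ √(κ - x^2) := Real.le_sqrt_of_sq_le h
    set t := √(κ - x^2)
    have e : c * (-c * t + a * x) = a * (a * t + c * x) - t := by linear_combination (-t) * hac
    have ha : |a| ≤ 1 := abs_le_one_iff_mul_self_le_one.2 (by nlinarith)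
    have : a * (a * t + c * x) ≤ |a| * |a * t + c * x| := by rw [← abs_mul]; exact le_abs_self _
    have : |a| * |a * t + c * x| ≤ 1 * |a * t + c * x| := by gcongr
    linarith
  have k1 := key x₁ h1 hb1
  have k2 := key x₂ h2 hb2
  have t1 : √(κ - x₁^2)^2 = κ - x₁^2 := Real.sq_sqrt (le_trans (sq_nonneg ρ) h1)
  have t2 : √(κ - x₂^2)^2 = κ - x₂^2 := Real.sq_sqrt (le_trans (sq_nonneg ρ) h2)
  generalize √(κ - x₁^2) = s₁ at *
  generalize √(κ - x₂^2) = s₂ at *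
  clear key
  obtain ⟨ψ₁, hψ₁⟩ : ∃ ψ₁, ψ₁ = a * s₁ + c * x₁ := ⟨_, rfl⟩
  obtain ⟨ψ₂, hψ₂⟩ : ∃ ψ₂, ψ₂ = a * s₂ + c * x₂ := ⟨_, rfl⟩
  obtain ⟨χ₁, hχ₁⟩ : ∃ χ₁, χ₁ = -c * s₁ + a * x₁ := ⟨_, rfl⟩
  obtain ⟨χ₂, hχ₂⟩ : ∃ χ₂, χ₂ = -c * s₂ + a * x₂ := ⟨_, rfl⟩
  rw [← hψ₁] at hb1
  rw [← hψ₂] at hb2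
  rw [← hχ₁] at k1
  rw [← hχ₂] at k2
  have n1 : ψ₁^2 + χ₁^2 = κ := by
    rw [hψ₁, hχ₁]; linear_combination (s₁^2 + x₁^2) * hac + t1
  have n2 : ψ₂^2 + χ₂^2 = κ := by
    rw [hψ₂, hχ₂]; linear_combination (s₂^2 + x₂^2) * hac + t2
  have e : (ψ₁ - ψ₂)^2 + (χ₁ - χ₂)^2 = (s₁ - s₂)^2 + (x₁ - x₂)^2 := by
    rw [hψ₁, hψ₂, hχ₁, hχ₂]; linear_combination ((s₁ - s₂)^2 + (x₁ - x₂)^2) * hac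
  have hκ : 0 ≤ κ - ρ^2 := by linarith [sq_nonneg x₁]
  clear hψ₁ hψ₂ hχ₁ hχ₂ t1 t2 hac h1 h2
  have hp : 0 < χ₁ * χ₂ := by
    have := mul_pos_of_neg_of_neg k1 k2
    have h' : 0 < c^2 * (χ₁ * χ₂) := by linarith
    exact pos_of_mul_pos_right h' (sq_nonneg c)
  have b1 : ψ₁^2 ≤ ρ^2 := sq_le_sq' (by linarith [(abs_lt.1 hb1).1]) (abs_lt.1 hb1).2.le
  have b2 : ψ₂^2 ≤ ρ^2 := sq_le_sq' (by linarith [(abs_lt.1 hb2).1]) (abs_lt.1 hb2).2.le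
  have hq : κ - ρ^2 ≤ χ₁ * χ₂ := by
    apply (abs_le_of_sq_le_sq' _ hp.le).2
    have : (κ - ρ^2) * (κ - ρ^2) ≤ χ₁^2 * χ₂^2 := by
      apply mul_le_mul _ _ hκ (sq_nonneg _) <;> linarith
    linarith
  have hψ : -ρ^2 ≤ ψ₁ * ψ₂ := by linarith [sq_nonneg (ψ₁ + ψ₂)]
  apply abs_le_of_sq_le_sq _ (by positivity)
  linarith [sq_nonneg (s₁ - s₂)]

lemma exists_basis (n : ℕ) (v : EuclideanSpace ℝ (Fin (n+1))) (hv : ‖v‖ = 1) :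
    ∃ b : OrthonormalBasis (Fin (n+1)) ℝ (EuclideanSpace ℝ (Fin (n+1))), b 0 = v := by
  have h : Orthonormal ℝ (({0} : Set (Fin (n+1))).domRestrict (fun _ => v)) := by
    constructor
    · intro i; simpa using hv
    · intro i j hij
      exact absurd (Subsingleton.elim i j) hij
  obtain ⟨b, hb⟩ := h.exists_orthonormalBasis_extension_of_card_eq (by simp)
  exact ⟨b, hb 0 rfl⟩

lemma exists_split (m : ℕ) (v : EuclideanSpace ℝ (Fin (m+1))) (hv : ‖v‖ = 1) :
    ∃ Ψ : EuclideanSpace ℝ (Fin (m+1)) → ℝ × EuclideanSpace ℝ (Fin m), MeasurePreserving Ψ ∧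
      ∀ z, (Ψ z).1 = inner ℝ v z ∧ ‖z‖^2 = (Ψ z).1^2 + ‖(Ψ z).2‖^2 := by
  obtain ⟨b, hb⟩ := exists_basis m v hv
  refine ⟨fun z => (b.repr z 0, WithLp.toLp 2 (fun i : Fin m => b.repr z i.succ)), ?_, ?_⟩
  · have h1 := b.measurePreserving_repr
    have h2 := PiLp.volume_preserving_ofLp (Fin (m+1))
    have h3 := volume_preserving_piFinSuccAbove (fun _ : Fin (m + 1) => ℝ) 0
    have h4 : MeasurePreserving (Prod.map (id : ℝ → ℝ) (@WithLp.toLp 2 (Fin m → ℝ))) :=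
      (MeasurePreserving.id volume).prod (PiLp.volume_preserving_toLp (Fin m))
    have h5 := h4.comp (h3.comp (h2.comp h1))
    exact h5
  · intro z
    constructor
    · simp [b.repr_apply_apply, hb]
    · rw [← b.repr.norm_map z, EuclideanSpace.norm_sq_eq, EuclideanSpace.norm_sq_eq, Fin.sum_univ_succ]
      simp

lemma vol_split {m : ℕ} {Ψ : EuclideanSpace ℝ (Fin (m+1)) → ℝ × EuclideanSpace ℝ (Fin m)}
    (hΨ : MeasurePreserving Ψ) {P : Set (ℝ × EuclideanSpace ℝ (Fin m))} (hP : MeasurableSet P) :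
    volume (Ψ ⁻¹' P) = ∫⁻ y, volume {x : ℝ | (x, y) ∈ P} := by
  rw [hΨ.measure_preimage hP.nullMeasurableSet]
  exact Measure.prod_apply_symm hP

lemma band_le (m : ℕ) (a S ρ : ℝ) (w : EuclideanSpace ℝ (Fin (m+1))) (haw : a^2 + ‖w‖^2 = 1)
    (hS : 0 < S) (hρ0 : 0 < ρ) (hρ : ρ^2 ≤ 1/S^2 - 1) :
    volume {z : EuclideanSpace ℝ (Fin (m+1)) | ‖z‖ < 1 ∧ |a * √(1 - S^2 * ‖z‖^2) + S * inner ℝ w z| < S * ρ}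
     ≤ ∫⁻ y : EuclideanSpace ℝ (Fin m), ENNReal.ofReal (2 * min ρ (√(1 - ‖y‖^2))) := by
  obtain ⟨v, hv, hw⟩ : ∃ v : EuclideanSpace ℝ (Fin (m+1)), ‖v‖ = 1 ∧ w = ‖w‖ • v := by
    rcases eq_or_ne w 0 with rfl | h
    · exact ⟨EuclideanSpace.single 0 1, by simp, by simp⟩
    · refine ⟨‖w‖⁻¹ • w, by simp [norm_smul, h], by simp [smul_smul, h]⟩
  obtain ⟨Ψ, hΨ, hΨ'⟩ := exists_split m v hv
  set c := ‖w‖ with hc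
  set P : Set (ℝ × EuclideanSpace ℝ (Fin m)) := {q | q.1^2 + ‖q.2‖^2 < 1 ∧
    |a * √(1 - S^2 * (q.1^2 + ‖q.2‖^2)) + S * (c * q.1)| < S * ρ} with hPdef
  have hP : MeasurableSet P := by
    rw [hPdef, Set.ofPred_and]
    exact ((isOpen_lt (by fun_prop) (by fun_prop)).inter
      (isOpen_lt (by fun_prop) (by fun_prop))).measurableSet
  have e : {z : EuclideanSpace ℝ (Fin (m+1)) | ‖z‖ < 1 ∧ |a * √(1 - S^2 * ‖z‖^2) + S * inner ℝ w z| < S * ρ} = Ψ ⁻¹' P := by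
    ext z
    obtain ⟨h1, h2⟩ := hΨ' z
    simp only [mem_ofPred_eq, mem_preimage, hPdef]
    rw [← h2, h1, hw, real_inner_smul_left, sq_lt_one_iff₀ (norm_nonneg z)]
  rw [e, vol_split hΨ hP]
  apply lintegral_mono
  intro y
  dsimp only
  rw [mul_min_of_nonneg _ _ (by norm_num : (0:ℝ) ≤ 2), ENNReal.ofReal_min]
  apply le_min
  · refine (Real.volume_le_diam _).trans (ediam_le ?_)
    have hk : ∀ x : ℝ, (x, y) ∈ P → ρ^2 ≤ (1/S^2 - ‖y‖^2) - x^2 ∧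
        |a * √((1/S^2 - ‖y‖^2) - x^2) + c * x| < ρ := by
      rintro x ⟨hx1, hx2⟩
      dsimp only at hx1 hx2
      refine ⟨by linarith, ?_⟩
      have : √(1 - S^2 * (x^2 + ‖y‖^2)) = S * √((1/S^2 - ‖y‖^2) - x^2) := by
        rw [← Real.sqrt_sq hS.le, ← Real.sqrt_mul (by positivity), Real.sqrt_sq hS.le]
        congr 1
        field_simp
        ring
      rw [this, show a * (S * √((1/S^2 - ‖y‖^2) - x^2)) + S * (c * x) = S * (a * √((1/S^2 - ‖y‖^2) - x^2) + c * x) by ring, abs_mul, abs_of_pos hS] at hx2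
      exact lt_of_mul_lt_mul_left hx2 hS.le
    intro x₁ hx₁ x₂ hx₂
    rw [edist_dist, Real.dist_eq]
    apply ENNReal.ofReal_le_ofReal
    exact aux_section a c _ ρ x₁ x₂ haw hρ0 (hk x₁ hx₁).1 (hk x₂ hx₂).1 (hk x₁ hx₁).2 (hk x₂ hx₂).2
  · have : {x : ℝ | (x, y) ∈ P} ⊆ Icc (-√(1 - ‖y‖^2)) (√(1 - ‖y‖^2)) := by
      rintro x ⟨hx1, hx2⟩
      dsimp only at hx1
      exact abs_le.1 (Real.abs_le_sqrt (by linarith))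
    refine (measure_mono this).trans ?_
    rw [Real.volume_Icc]
    apply ENNReal.ofReal_le_ofReal
    linarith

lemma le_cone (m : ℕ) (θ : ℝ) (v : EuclideanSpace ℝ (Fin (m+1))) (hv : ‖v‖ = 1) 
    (h0 : 0 < θ) (h1 : θ < Real.pi / 4) :
    ∫⁻ y : EuclideanSpace ℝ (Fin m), ENNReal.ofReal (2 * min (Real.tan (2*θ) * ‖y‖) (√(1 - ‖y‖^2)))
    ≤ volume {z : EuclideanSpace ℝ (Fin (m+1)) | ‖z‖ < 1 ∧ |inner ℝ v z| < Real.sin (2*θ) * ‖z‖} := by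
  have hpi := Real.pi_pos
  have hsin2 : 0 < Real.sin (2*θ) := Real.sin_pos_of_pos_of_lt_pi (by linarith) (by linarith)
  have hcos2 : 0 < Real.cos (2*θ) := Real.cos_pos_of_mem_Ioo ⟨by linarith, by linarith⟩
  obtain ⟨Ψ, hΨ, hΨ'⟩ := exists_split m v hv
  set P : Set (ℝ × EuclideanSpace ℝ (Fin m)) := {q | q.1^2 + ‖q.2‖^2 < 1 ∧
    |q.1| < Real.sin (2*θ) * √(q.1^2 + ‖q.2‖^2)} with hPdef
  have hP : MeasurableSet P := by
    rw [hPdef, Set.ofPred_and]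
    exact ((isOpen_lt (by fun_prop) (by fun_prop)).inter
      (isOpen_lt (by fun_prop) (by fun_prop))).measurableSet
  have e : {z : EuclideanSpace ℝ (Fin (m+1)) | ‖z‖ < 1 ∧ |inner ℝ v z| < Real.sin (2*θ) * ‖z‖} = Ψ ⁻¹' P := by
    ext z
    obtain ⟨h1, h2⟩ := hΨ' z
    simp only [mem_ofPred_eq, mem_preimage, hPdef]
    rw [← h2, h1, sq_lt_one_iff₀ (norm_nonneg z), Real.sqrt_sq (norm_nonneg z)]
  rw [e, vol_split hΨ hP]
  apply lintegral_mono
  intro y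
  dsimp only
  set M := min (Real.tan (2*θ) * ‖y‖) (√(1 - ‖y‖^2)) with hM
  have : Ioo (-M) M ⊆ {x : ℝ | (x, y) ∈ P} := by
    intro x hx
    have hx' : |x| < M := abs_lt.2 hx
    have hx1 : |x| < Real.tan (2*θ) * ‖y‖ := lt_of_lt_of_le hx' (min_le_left _ _)
    have hx2 : |x| < √(1 - ‖y‖^2) := lt_of_lt_of_le hx' (min_le_right _ _)
    rw [Real.lt_sqrt (abs_nonneg x), sq_abs] at hx2
    refine ⟨by dsimp only; linarith, ?_⟩
    dsimp only
    rw [Real.tan_eq_sin_div_cos, div_mul_eq_mul_div, lt_div_iff₀ hcos2] at hx1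
    rw [← Real.sqrt_sq hsin2.le, ← Real.sqrt_mul (by positivity), Real.lt_sqrt (abs_nonneg x), sq_abs]
    have h3 : (|x| * Real.cos (2*θ))^2 < (Real.sin (2*θ) * ‖y‖)^2 := by gcongr
    rw [mul_pow, mul_pow, sq_abs, Real.cos_sq'] at h3
    linarith
  refine le_trans ?_ (measure_mono this)
  rw [Real.volume_Ioo]
  apply ENNReal.ofReal_le_ofReal
  linarith

lemma aux_lint (m : ℕ) (hm : 1 ≤ m) (θ : ℝ) (h0 : 0 < θ) (h1 : θ < Real.pi / 4) :
    ∫⁻ y : EuclideanSpace ℝ (Fin m), ENNReal.ofReal (2 * min (Real.sin θ) (√(1 - ‖y‖^2)))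
    ≤ ∫⁻ y : EuclideanSpace ℝ (Fin m), ENNReal.ofReal (2 * min (Real.tan (2*θ) * ‖y‖) (√(1 - ‖y‖^2))) := by
  have hpi := Real.pi_pos
  have hsin : 0 < Real.sin θ := Real.sin_pos_of_pos_of_lt_pi h0 (by linarith)
  have hsin2 : 0 < Real.sin (2*θ) := Real.sin_pos_of_pos_of_lt_pi (by linarith) (by linarith)
  have hcos2 : 0 < Real.cos (2*θ) := Real.cos_pos_of_mem_Ioo ⟨by linarith, by linarith⟩
  have hTpos : 0 < Real.tan (2*θ) := by rw [Real.tan_eq_sin_div_cos]; positivity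
  have : Nonempty (Fin m) := ⟨⟨0, hm⟩⟩
  have hint : ∀ g : EuclideanSpace ℝ (Fin m) → ℝ, Continuous g → (∀ y, 0 ≤ g y) →
      Integrable (fun y => min (g y) (√(1 - ‖y‖^2))) := by
    intro g hg hg0
    apply Continuous.integrable_of_hasCompactSupport (by fun_prop)
    apply HasCompactSupport.of_support_subset_isCompact (isCompact_closedBall 0 1)
    intro y hy
    by_contra h
    apply hy
    simp only [mem_closedBall, dist_zero_right, not_le] at h
    dsimp only
    rw [Real.sqrt_eq_zero_of_nonpos (by nlinarith), min_eq_right (hg0 y)]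
  have i1 := hint (fun _ => Real.sin θ) (by fun_prop) (fun _ => hsin.le)
  have i2 := hint (fun y => Real.tan (2*θ) * ‖y‖) (by fun_prop) (fun _ => by positivity)
  rw [← ofReal_integral_eq_lintegral_ofReal (i1.const_mul 2)
      (Filter.Eventually.of_forall (fun y => by dsimp only; positivity)),
    ← ofReal_integral_eq_lintegral_ofReal (i2.const_mul 2)
      (Filter.Eventually.of_forall (fun y => by dsimp only; positivity))]
  apply ENNReal.ofReal_le_ofReal
  rw [integral_const_mul, integral_const_mul]
  apply mul_le_mul_of_nonneg_left _ (by norm_num)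
  rw [← sub_nonpos, ← integral_sub i1 i2]
  have := integral_fun_norm_addHaar (volume : Measure (EuclideanSpace ℝ (Fin m)))
    (fun y => min (Real.sin θ) (√(1 - y^2)) - min (Real.tan (2*θ) * y) (√(1 - y^2)))
  rw [this]
  have := aux_weighted θ (Module.finrank ℝ (EuclideanSpace ℝ (Fin m)) - 1) h0 h1
  rw [smul_eq_mul, nsmul_eq_mul]
  apply mul_nonpos_of_nonneg_of_nonpos (by positivity)
  apply mul_nonpos_of_nonneg_of_nonpos (by positivity) this

open scoped Pointwise in
lemma cone_vol (n : ℕ) (p : EuclideanSpace ℝ (Fin (n+1))) (c : ℝ) :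
    sphMeasure n {x : Sph n | c ≤ inner ℝ (x : EuclideanSpace ℝ (Fin (n+1))) p} *
      volume (ball (0 : EuclideanSpace ℝ (Fin (n+1))) 1)
    = volume {z : EuclideanSpace ℝ (Fin (n+1)) | ‖z‖ < 1 ∧ z ≠ 0 ∧ c * ‖z‖ ≤ inner ℝ z p} := by
  have hm : MeasurableSet {x : Sph n | c ≤ inner ℝ (x : EuclideanSpace ℝ (Fin (n+1))) p} :=
    (isClosed_le (by fun_prop) (by fun_prop)).measurableSet
  have hV0 : volume (ball (0 : EuclideanSpace ℝ (Fin (n+1))) 1) ≠ 0 :=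
    (measure_ball_pos _ _ one_pos).ne'
  have hV1 : volume (ball (0 : EuclideanSpace ℝ (Fin (n+1))) 1) ≠ ∞ := measure_ball_lt_top.ne
  have hset : (Ioo (0 : ℝ) 1 : Set ℝ) • ((Subtype.val : Sph n → EuclideanSpace ℝ (Fin (n+1))) '' {x : Sph n | c ≤ inner ℝ (x : EuclideanSpace ℝ (Fin (n+1))) p})
     = {z : EuclideanSpace ℝ (Fin (n+1)) | ‖z‖ < 1 ∧ z ≠ 0 ∧ c * ‖z‖ ≤ inner ℝ z p} := by
    ext z
    simp only [Set.mem_smul, mem_image, mem_ofPred_eq]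
    constructor
    · rintro ⟨t, ⟨ht0, ht1⟩, _, ⟨x, hx, rfl⟩, rfl⟩
      have hx1 : ‖(x : EuclideanSpace ℝ (Fin (n+1)))‖ = 1 := norm_eq_of_mem_sphere x
      refine ⟨by rw [norm_smul, hx1, Real.norm_of_nonneg ht0.le]; linarith, ?_, ?_⟩
      · apply smul_ne_zero ht0.ne'
        intro h; rw [h] at hx1; simp at hx1
      · rw [norm_smul, hx1, Real.norm_of_nonneg ht0.le, real_inner_smul_left]
        have := mul_le_mul_of_nonneg_left hx ht0.le
        linarith
    · rintro ⟨h1, h2, h3⟩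
      have hz : 0 < ‖z‖ := norm_pos_iff.2 h2
      refine ⟨‖z‖, ⟨hz, h1⟩, ‖z‖⁻¹ • z, ⟨⟨‖z‖⁻¹ • z, by simp [norm_smul, h2]⟩, ?_, rfl⟩, by simp [smul_smul, h2]⟩
      dsimp only
      rw [real_inner_smul_left, inv_mul_eq_div, le_div_iff₀ hz]
      exact h3
  have hdim : ((Module.finrank ℝ (EuclideanSpace ℝ (Fin (n+1))) : ℕ) : ℝ≥0∞) ≠ 0 := by
    simp
  rw [sphMeasure, Measure.smul_apply, Measure.toSphere_apply' _ hm, hset, Measure.toSphere_apply_univ, smul_eq_mul,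
    ENNReal.mul_inv (Or.inl hdim) (Or.inr hV0)]
  generalize volume {z : EuclideanSpace ℝ (Fin (n+1)) | ‖z‖ < 1 ∧ z ≠ 0 ∧ c * ‖z‖ ≤ inner ℝ z p} = X
  generalize volume (ball (0 : EuclideanSpace ℝ (Fin (n+1))) 1) = V at *
  generalize ((Module.finrank ℝ (EuclideanSpace ℝ (Fin (n+1))) : ℕ)) = D at *
  calc _ = ((D:ℝ≥0∞)⁻¹ * D) * (V⁻¹ * V) * X := by ring
    _ = X := by rw [ENNReal.inv_mul_cancel hdim (by simp), ENNReal.inv_mul_cancel hV0 hV1]; simp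

lemma cap_rot (n : ℕ) (p : EuclideanSpace ℝ (Fin (n+1))) (hp : ‖p‖ = 1) (c : ℝ) :
    sphMeasure n {x : Sph n | c ≤ inner ℝ (x : EuclideanSpace ℝ (Fin (n+1))) p} =
    sphMeasure n {x : Sph n | c ≤ inner ℝ (x : EuclideanSpace ℝ (Fin (n+1))) (EuclideanSpace.single 0 1)} := by
  have hV0 : volume (ball (0 : EuclideanSpace ℝ (Fin (n+1))) 1) ≠ 0 :=
    (measure_ball_pos _ _ one_pos).ne'
  have hV1 : volume (ball (0 : EuclideanSpace ℝ (Fin (n+1))) 1) ≠ ∞ := measure_ball_lt_top.ne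
  rw [← ENNReal.mul_left_inj hV0 hV1, cone_vol, cone_vol]
  obtain ⟨b, hb⟩ := exists_basis n p hp
  have he : b.repr p = EuclideanSpace.single 0 1 := by rw [← hb]; exact b.repr_self 0
  symm
  rw [← b.repr.measurePreserving.measure_preimage_equiv (f := b.repr.toMeasurableEquiv)]
  congr 1
  ext z
  simp only [mem_ofPred_eq, mem_preimage]
  change ‖b.repr z‖ < 1 ∧ b.repr z ≠ 0 ∧ c * ‖b.repr z‖ ≤ inner ℝ (b.repr z) _ ↔ _
  rw [← he, LinearIsometryEquiv.inner_map_map, LinearIsometryEquiv.norm_map]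
  simp

lemma sph_prob (n : ℕ) : sphMeasure n univ = 1 := by
  rw [sphMeasure, Measure.smul_apply, smul_eq_mul]
  apply ENNReal.inv_mul_cancel
  · simp only [ne_eq, Measure.measure_univ_eq_zero]
    exact Measure.toSphere_ne_zero _
  · exact measure_ne_top _ _

open scoped Pointwise in
lemma half_lemma (n : ℕ) (t s : ℝ) (hs : 0 < s) (hst : Real.cos t = s) :
    2 * capMeasure n t * volume (ball (0 : EuclideanSpace ℝ (Fin (n+1))) 1) +
    volume {z : EuclideanSpace ℝ (Fin (n+1)) | ‖z‖ < 1 ∧ |inner ℝ (EuclideanSpace.single 0 1) z| < s * ‖z‖}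
    ≤ volume (ball (0 : EuclideanSpace ℝ (Fin (n+1))) 1) := by
  rw [mul_assoc, capMeasure, hst, cone_vol]
  set e : EuclideanSpace ℝ (Fin (n+1)) := EuclideanSpace.single 0 1 
  set D := {z : EuclideanSpace ℝ (Fin (n+1)) | ‖z‖ < 1 ∧ z ≠ 0 ∧ s * ‖z‖ ≤ inner ℝ z e} with hD
  set B := {z : EuclideanSpace ℝ (Fin (n+1)) | ‖z‖ < 1 ∧ |inner ℝ e z| < s * ‖z‖} with hB
  have hDm : MeasurableSet D := by
    rw [hD, ofPred_and, ofPred_and]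
    exact (isOpen_lt (by fun_prop) (by fun_prop)).measurableSet.inter
      ((measurableSet_singleton 0).compl.inter (isClosed_le (by fun_prop) (by fun_prop)).measurableSet)
  have hBm : MeasurableSet B := by
    rw [hB, ofPred_and]
    exact (isOpen_lt (by fun_prop) (by fun_prop)).measurableSet.inter
      (isOpen_lt (by fun_prop) (by fun_prop)).measurableSet
  have hneg : volume (-D) = volume D := Measure.measure_neg _ _
  have d1 : Disjoint D (-D) := by
    rw [Set.disjoint_left]
    rintro z ⟨h1, h2, h3⟩ ⟨h1', h2', h3'⟩
    rw [norm_neg, inner_neg_left] at h3'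
    have : 0 < s * ‖z‖ := mul_pos hs (norm_pos_iff.2 h2)
    linarith
  have d2 : Disjoint (D ∪ -D) B := by
    rw [Set.disjoint_left]
    rintro z hz ⟨h1, h2⟩
    rw [real_inner_comm, abs_lt] at h2
    rcases hz with ⟨_, _, h3⟩ | ⟨_, _, h3⟩
    · linarith
    · rw [norm_neg, inner_neg_left] at h3
      linarith
  rw [two_mul]
  nth_rewrite 2 [← hneg]
  rw [← measure_union d1 hDm.neg, ← measure_union d2 hBm]
  apply measure_mono
  rintro z ((⟨h, _⟩ | ⟨h, _⟩) | ⟨h, _⟩)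
  · simpa using h
  · simpa using h
  · simpa using h

lemma exists_L (n : ℕ) (x : EuclideanSpace ℝ (Fin (n+2))) (hx : ‖x‖ = 1) :
    ∃ L : EuclideanSpace ℝ (Fin (n+1)) → EuclideanSpace ℝ (Fin (n+2)), Continuous L ∧
      (∀ z, ‖L z‖ = ‖z‖) ∧ (∀ z, inner ℝ x (L z) = 0) ∧
      ∀ u, ∃ w, (∀ z, inner ℝ u (L z) = inner ℝ w z) ∧ (inner ℝ u x)^2 + ‖w‖^2 = ‖u‖^2 := by
  obtain ⟨b, hb⟩ := exists_basis (n+1) x hx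
  have hbx : ∀ u, inner ℝ x u = b.repr u 0 := by
    intro u; rw [b.repr_apply_apply, hb]
  refine ⟨fun z => b.repr.symm (WithLp.toLp 2 (Fin.cons 0 z.ofLp)), ?_, ?_, ?_, ?_⟩
  · apply b.repr.symm.continuous.comp
    apply (PiLp.continuous_toLp 2 _).comp
    apply continuous_pi
    intro i
    refine Fin.cases ?_ (fun j => ?_) i
    · simp only [Fin.cons_zero]; exact continuous_const
    · simp only [Fin.cons_succ]; fun_prop
  · intro z
    rw [LinearIsometryEquiv.norm_map, ← sq_eq_sq₀ (norm_nonneg _) (norm_nonneg _),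
      EuclideanSpace.norm_sq_eq, EuclideanSpace.norm_sq_eq, Fin.sum_univ_succ]
    simp
  · intro z
    rw [hbx]; simp
  · intro u
    refine ⟨WithLp.toLp 2 (fun i => b.repr u i.succ), ?_, ?_⟩
    · intro z
      rw [← b.repr.inner_map_map u, LinearIsometryEquiv.apply_symm_apply, PiLp.inner_apply, PiLp.inner_apply,
        Fin.sum_univ_succ]
      simp
    · rw [real_inner_comm, hbx, ← b.repr.norm_map u, EuclideanSpace.norm_sq_eq, EuclideanSpace.norm_sq_eq, Fin.sum_univ_succ (n := n+1)]
      simp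

lemma average_lemma {F G : Type*} [MeasurableSpace F] [MeasurableSpace G] (ν : Measure F) (μ : Measure G)
    [SFinite ν] [IsProbabilityMeasure μ] (U : Set F) (hU0 : ν U ≠ 0) (hU1 : ν U ≠ ∞)
    (P : Set (F × G)) (hP : MeasurableSet P) (K : ℝ≥0∞)
    (h : ∀ u, ν.restrict U {z | (z, u) ∈ P} ≤ K) :
    ∃ z ∈ U, μ {u | (z, u) ∈ P} * ν U ≤ K := by
  have hm : Measurable (fun z => μ {u | (z, u) ∈ P}) := measurable_measure_prodMk_left hP
  obtain ⟨z, hz, hle⟩ := exists_le_setLAverage hU0 hU1 hm.aemeasurable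
  refine ⟨z, hz, ?_⟩
  rw [setLAverage_eq] at hle
  have h1 : ∫⁻ z in U, μ {u | (z, u) ∈ P} ∂ν ≤ K := by
    have e1 : ∫⁻ z in U, μ {u | (z, u) ∈ P} ∂ν = (ν.restrict U).prod μ P := (Measure.prod_apply hP).symm
    rw [e1, Measure.prod_apply_symm hP]
    calc _ ≤ ∫⁻ u, K ∂μ := lintegral_mono h
      _ = K := by simp
  calc _ ≤ (∫⁻ z in U, μ {u | (z, u) ∈ P} ∂ν) / ν U * ν U := by gcongr
    _ = ∫⁻ z in U, μ {u | (z, u) ∈ P} ∂ν := ENNReal.div_mul_cancel hU0 hU1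
    _ ≤ K := h1

lemma band_cone (m : ℕ) (hm : 1 ≤ m) (θ S : ℝ) (h0 : 0 < θ) (h1 : θ < Real.pi / 4) (hS : 0 < S)
    (hSθ : Real.sin θ ^ 2 ≤ 1 / S^2 - 1) (μ : Measure (Sph (m+1))) [IsProbabilityMeasure μ]
    (x : Sph (m+1)) :
    ∃ p : Sph (m+1), √(1 - S^2) ≤ inner ℝ (p : EuclideanSpace ℝ (Fin (m+2))) (x : EuclideanSpace ℝ (Fin (m+2))) ∧
      2 * capMeasure m (Real.pi / 2 - 2 * θ) +
        μ {u | |inner ℝ (u : EuclideanSpace ℝ (Fin (m+2))) (p : EuclideanSpace ℝ (Fin (m+2)))| < S * Real.sin θ} ≤ 1 := by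
  have hpi := Real.pi_pos
  have hsin : 0 < Real.sin θ := Real.sin_pos_of_pos_of_lt_pi h0 (by linarith)
  have hsin2 : 0 < Real.sin (2*θ) := Real.sin_pos_of_pos_of_lt_pi (by linarith) (by linarith)
  have hx : ‖(x : EuclideanSpace ℝ (Fin (m+2)))‖ = 1 := norm_eq_of_mem_sphere x
  obtain ⟨L, hLc, hLn, hLx, hLu⟩ := exists_L m x hx
  have hV0 : volume (ball (0 : EuclideanSpace ℝ (Fin (m+1))) 1) ≠ 0 :=
    (measure_ball_pos _ _ one_pos).ne'
  have hV1 : volume (ball (0 : EuclideanSpace ℝ (Fin (m+1))) 1) ≠ ∞ := measure_ball_lt_top.ne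
  let q : EuclideanSpace ℝ (Fin (m+1)) → EuclideanSpace ℝ (Fin (m+2)) :=
    fun z => √(1 - S^2 * ‖z‖^2) • (x : EuclideanSpace ℝ (Fin (m+2))) + S • L z
  have hqc : Continuous q := by
    have : Continuous (fun z : EuclideanSpace ℝ (Fin (m+1)) => √(1 - S^2 * ‖z‖^2)) := by fun_prop
    exact (this.smul continuous_const).add (hLc.const_smul S)
  have hS1 : S^2 ≤ 1 := by
    have : 0 ≤ 1/S^2 - 1 := le_trans (sq_nonneg _) hSθ
    rw [sub_nonneg, le_div_iff₀ (by positivity)] at this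
    linarith
  let P : Set (EuclideanSpace ℝ (Fin (m+1)) × Sph (m+1)) :=
    {y | |inner ℝ (y.2 : EuclideanSpace ℝ (Fin (m+2))) (q y.1)| < S * Real.sin θ}
  have hP : MeasurableSet P := by
    apply IsOpen.measurableSet
    refine isOpen_lt (Continuous.abs ?_) continuous_const
    exact (continuous_subtype_val.comp continuous_snd).inner (hqc.comp continuous_fst)
  obtain ⟨z, hz, hle⟩ := average_lemma volume μ (ball (0 : EuclideanSpace ℝ (Fin (m+1))) 1) hV0 hV1 P hP
    (volume {z : EuclideanSpace ℝ (Fin (m+1)) | ‖z‖ < 1 ∧ |inner ℝ (EuclideanSpace.single 0 1) z| < Real.sin (2*θ) * ‖z‖}) (by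
      intro u
      obtain ⟨w, hw1, hw2⟩ := hLu u
      rw [norm_eq_of_mem_sphere u, one_pow] at hw2
      refine le_trans ?_ ((band_le m _ S (Real.sin θ) w hw2 hS hsin hSθ).trans
        ((aux_lint m hm θ h0 h1).trans (le_cone m θ (EuclideanSpace.single 0 1) (by simp) h0 h1)))
      have hms : MeasurableSet {z | (z, u) ∈ P} := measurable_prodMk_right hP
      rw [Measure.restrict_apply hms]
      apply measure_mono
      rintro z ⟨hz1, hz2⟩
      refine ⟨by simpa using hz2, ?_⟩
      have hz1' : |inner ℝ (u : EuclideanSpace ℝ (Fin (m+2))) (q z)| < S * Real.sin θ := hz1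
      simp only [q, inner_add_right, inner_smul_right, hw1] at hz1'
      rw [mul_comm (inner ℝ _ _)]
      exact hz1')
  have hz' : ‖z‖ < 1 := by simpa using hz
  have hzs : ‖z‖^2 ≤ 1 := by nlinarith [norm_nonneg z]
  have hpos : 0 ≤ 1 - S^2 * ‖z‖^2 := by nlinarith [sq_nonneg S]
  have hqn : ‖q z‖ = 1 := by
    rw [← sq_eq_sq₀ (norm_nonneg _) zero_le_one, norm_add_sq_real, norm_smul, norm_smul, hLn, hx,
      real_inner_smul_left, real_inner_smul_right, hLx, Real.norm_of_nonneg (Real.sqrt_nonneg _), Real.norm_of_nonneg hS.le,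
      mul_pow, Real.sq_sqrt hpos]
    ring
  refine ⟨⟨q z, by simpa using hqn⟩, ?_, ?_⟩
  · simp only [q, inner_add_left, real_inner_smul_left]
    rw [real_inner_comm _ (L z), hLx, real_inner_self_eq_norm_sq, hx]
    simp only [one_pow, mul_one, mul_zero, add_zero]
    apply Real.sqrt_le_sqrt
    nlinarith [sq_nonneg S]
  · have hh := half_lemma m (Real.pi / 2 - 2 * θ) (Real.sin (2*θ)) hsin2 (Real.cos_pi_div_two_sub _)
    rw [← ENNReal.mul_le_mul_iff_left hV0 hV1, add_mul, one_mul]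
    exact (add_le_add_right hle _).trans hh

/-- Pairs in C_d(Δ): if μ1 is a probability measure on S^d whose density with respect to
σ_d is (nonnegative and) Lipschitz with constant at most Δ for the geodesic distance, and
μ2 is a nice measure on S^d, then with R = min((1−λ)/Δ, π/2) and 0 < r ≤ R/4 with
2·arcsin(sin r / sin(R−r)) ≤ π/2, there are sets A, B with
μ1(A) ≥ λ·h_d(r), μ2(B) ≥ h_{d−1}(π/2 − 2·arcsin(sin r / sin(R−r))) on which the inner
product has constant sign. -/
theorem lipschitz_pairs (d : ℕ) (hd : 2 ≤ d) (Δ lam r R : ℝ) (hΔ : 0 < Δ)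
    (hlam0 : 0 < lam) (hlam1 : lam ≤ 1) (hR : R = min ((1 - lam) / Δ) (Real.pi / 2))
    (hr0 : 0 < r) (hr : r ≤ R / 4)
    (harc : 2 * Real.arcsin (Real.sin r / Real.sin (R - r)) ≤ Real.pi / 2)
    (f : Sph d → ℝ) (hf0 : ∀ x, 0 ≤ f x)
    (hlip : ∀ x y : Sph d, |f x - f y| ≤ Δ *
      Real.arccos (inner (𝕜 := ℝ) (x : EuclideanSpace ℝ (Fin (d + 1)))
        (y : EuclideanSpace ℝ (Fin (d + 1)))))
    (μ1 μ2 : Measure (Sph d))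
    (hμ1 : μ1 = (sphMeasure d).withDensity (fun x => ENNReal.ofReal (f x)))
    (hμ1p : IsProbabilityMeasure μ1) (hμ2 : NiceSphMeasure d μ2) :
    ∃ A B : Set (Sph d),
      ENNReal.ofReal lam * capMeasure d r ≤ μ1 A ∧
      capMeasure (d - 1) (Real.pi / 2 - 2 * Real.arcsin (Real.sin r / Real.sin (R - r)))
        ≤ μ2 B ∧
      ((∀ a ∈ A, ∀ b ∈ B, 0 ≤ inner (𝕜 := ℝ) (a : EuclideanSpace ℝ (Fin (d + 1)))
          (b : EuclideanSpace ℝ (Fin (d + 1)))) ∨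
       (∀ a ∈ A, ∀ b ∈ B, inner (𝕜 := ℝ) (a : EuclideanSpace ℝ (Fin (d + 1)))
          (b : EuclideanSpace ℝ (Fin (d + 1))) ≤ 0)) := by
  obtain ⟨m, rfl⟩ : ∃ m, d = m + 1 := ⟨d - 1, by omega⟩
  have hm : 1 ≤ m := by omega
  have hpi := Real.pi_pos
  have hRpi : R ≤ Real.pi / 2 := by rw [hR]; exact min_le_right _ _
  have hRl : R ≤ (1 - lam) / Δ := by rw [hR]; exact min_le_left _ _
  have hΔR : Δ * R ≤ 1 - lam := by rw [le_div_iff₀ hΔ] at hRl; linarith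
  have hsr : 0 < Real.sin r := Real.sin_pos_of_pos_of_lt_pi hr0 (by linarith)
  have hS : 0 < Real.sin (R - r) := Real.sin_pos_of_pos_of_lt_pi (by linarith) (by linarith)
  have hρ0 : 0 < Real.sin r / Real.sin (R - r) := by positivity
  have hρ : Real.sin r / Real.sin (R - r) ≤ 1 / 2 := by
    rw [div_le_iff₀ hS]
    have h3 : Real.sin (3 * r) ≤ Real.sin (R - r) :=
      Real.sin_le_sin_of_le_of_le_pi_div_two (by linarith) (by linarith) (by linarith)
    rw [Real.sin_three_mul] at h3
    have h6 : Real.sin r ≤ 1 / 2 := by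
      rw [← Real.sin_pi_div_six]
      exact Real.sin_le_sin_of_le_of_le_pi_div_two (by linarith) (by linarith) (by linarith)
    have : Real.sin r ^ 3 ≤ Real.sin r * (1/4) := by
      rw [pow_succ']
      apply mul_le_mul_of_nonneg_left _ hsr.le
      nlinarith
    linarith
  have hsinθ : Real.sin (Real.arcsin (Real.sin r / Real.sin (R - r))) = Real.sin r / Real.sin (R - r) :=
    Real.sin_arcsin (by linarith) (by linarith)
  have hθ0 : 0 < Real.arcsin (Real.sin r / Real.sin (R - r)) := Real.arcsin_pos.2 hρ0
  have hθ1 : Real.arcsin (Real.sin r / Real.sin (R - r)) < Real.pi / 4 := by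
    have h6 : Real.arcsin (Real.sin r / Real.sin (R - r)) ≤ Real.pi / 6 := by
      rw [Real.arcsin_le_iff_le_sin ⟨by linarith, by linarith⟩ ⟨by linarith, by linarith⟩, Real.sin_pi_div_six]
      exact hρ
    linarith
  generalize Real.arcsin (Real.sin r / Real.sin (R - r)) = θ at *
  -- continuity and the choice of the centre
  have hfc : Continuous f := by
    rw [continuous_iff_continuousAt]
    intro x
    rw [ContinuousAt, tendsto_iff_dist_tendsto_zero]
    have hc : Continuous (fun y : Sph (m+1) => Δ * Real.arccos (inner ℝ (y : EuclideanSpace ℝ (Fin (m+1+1))) (x : EuclideanSpace ℝ (Fin (m+1+1))))) := by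
      apply continuous_const.mul
      exact Real.continuous_arccos.comp (continuous_subtype_val.inner continuous_const)
    have hl := hc.tendsto x
    rw [real_inner_self_eq_norm_sq, norm_eq_of_mem_sphere x, one_pow, Real.arccos_one, mul_zero] at hl
    exact squeeze_zero (fun _ => dist_nonneg) (fun y => by rw [Real.dist_eq]; exact hlip y x) hl
  obtain ⟨x, hx⟩ : ∃ x, 1 ≤ f x := by
    by_contra! hcon
    have h1 : μ1 univ = 1 := hμ1p.measure_univ
    rw [hμ1, withDensity_apply _ MeasurableSet.univ, Measure.restrict_univ] at h1
    have hne : sphMeasure (m+1) ≠ 0 := by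
      intro h0
      have := sph_prob (m+1)
      rw [h0] at this
      simp at this
    have h2 : ∫⁻ x, ENNReal.ofReal (f x) ∂(sphMeasure (m+1)) < ∫⁻ x, 1 ∂(sphMeasure (m+1)) := by
      apply lintegral_strict_mono hne
      · exact measurable_const.aemeasurable
      · rw [h1]; simp
      · refine Filter.Eventually.of_forall (fun x => ?_)
        rw [ENNReal.ofReal_lt_one]; exact hcon x
    rw [h1, lintegral_one, sph_prob] at h2
    exact lt_irrefl _ h2
  obtain ⟨hμ2p, -⟩ := hμ2
  have hcos : Real.sin r ≤ Real.cos (R - r) := by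
    rw [← Real.cos_pi_div_two_sub]
    exact Real.cos_le_cos_of_nonneg_of_le_pi (by linarith) (by linarith) (by linarith)
  have hcond : Real.sin θ ^ 2 ≤ 1 / Real.sin (R - r) ^ 2 - 1 := by
    rw [hsinθ, div_pow, le_sub_iff_add_le, div_add_one (by positivity)]
    apply div_le_div_of_nonneg_right _ (by positivity)
    have : Real.sin r ^ 2 ≤ Real.cos (R - r) ^ 2 := by gcongr
    linarith [Real.sin_sq_add_cos_sq (R - r)]
  obtain ⟨p, hpx, hband⟩ := band_cone m hm θ (Real.sin (R - r)) hθ0 hθ1 hS hcond μ2 x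
  rw [hsinθ, mul_div_cancel₀ _ hS.ne'] at hband
  have hcosR : √(1 - Real.sin (R - r) ^ 2) = Real.cos (R - r) := by
    rw [← Real.cos_sq', Real.sqrt_sq (by linarith)]
  rw [hcosR] at hpx
  have hn : ∀ u : Sph (m+1), ‖(u : EuclideanSpace ℝ (Fin (m+1+1)))‖ = 1 := fun u => norm_eq_of_mem_sphere u
  have hang : ∀ u v : Sph (m+1), InnerProductGeometry.angle (u : EuclideanSpace ℝ (Fin (m+1+1))) (v : EuclideanSpace ℝ (Fin (m+1+1)))
      = Real.arccos (inner ℝ (u : EuclideanSpace ℝ (Fin (m+1+1))) (v : EuclideanSpace ℝ (Fin (m+1+1)))) := by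
    intro u v
    simp [InnerProductGeometry.angle, hn]
  have harcle : ∀ (t y : ℝ), 0 ≤ t → t ≤ Real.pi → Real.cos t ≤ y → Real.arccos y ≤ t := by
    intro t y h0 h1 h
    rw [← Real.arccos_cos h0 h1]
    exact Real.arccos_le_arccos h
  have htri : ∀ (t s : ℝ) (u v w : Sph (m+1)), 0 ≤ t → t ≤ Real.pi → 0 ≤ s → s ≤ Real.pi →
      Real.cos t ≤ inner ℝ (u : EuclideanSpace ℝ (Fin (m+1+1))) (v : EuclideanSpace ℝ (Fin (m+1+1))) →
      Real.cos s ≤ inner ℝ (v : EuclideanSpace ℝ (Fin (m+1+1))) (w : EuclideanSpace ℝ (Fin (m+1+1))) →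
      Real.arccos (inner ℝ (u : EuclideanSpace ℝ (Fin (m+1+1))) (w : EuclideanSpace ℝ (Fin (m+1+1)))) ≤ t + s := by
    intro t s u v w h1 h2 h3 h4 h5 h6
    rw [← hang]
    refine (InnerProductGeometry.angle_le_angle_add_angle _ (v : EuclideanSpace ℝ (Fin (m+1+1))) _).trans ?_
    rw [hang, hang]
    exact add_le_add (harcle _ _ h1 h2 h5) (harcle _ _ h3 h4 h6)
  let A : Set (Sph (m+1)) := {a | Real.cos r ≤ inner ℝ (a : EuclideanSpace ℝ (Fin (m+1+1))) (p : EuclideanSpace ℝ (Fin (m+1+1)))}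
  let Bp : Set (Sph (m+1)) := {b | Real.sin r ≤ inner ℝ (b : EuclideanSpace ℝ (Fin (m+1+1))) (p : EuclideanSpace ℝ (Fin (m+1+1)))}
  let Bn : Set (Sph (m+1)) := {b | inner ℝ (b : EuclideanSpace ℝ (Fin (m+1+1))) (p : EuclideanSpace ℝ (Fin (m+1+1))) ≤ - Real.sin r}
  have hA : ENNReal.ofReal lam * capMeasure (m+1) r ≤ μ1 A := by
    have hAm : MeasurableSet A := (isClosed_le (by fun_prop) (by fun_prop)).measurableSet
    rw [capMeasure, ← cap_rot (m+1) p (hn p), hμ1, withDensity_apply _ hAm, ← setLIntegral_const]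
    apply setLIntegral_mono' hAm
    intro a ha
    apply ENNReal.ofReal_le_ofReal
    have h1 := htri r (R - r) a p x hr0.le (by linarith) (by linarith) (by linarith) ha hpx
    have h2 := hlip a x
    have h3 : Δ * Real.arccos (inner ℝ (a : EuclideanSpace ℝ (Fin (m+1+1))) (x : EuclideanSpace ℝ (Fin (m+1+1)))) ≤ Δ * R := by
      apply mul_le_mul_of_nonneg_left _ hΔ.le
      linarith
    have h4 := (abs_le.1 h2).1
    linarith
  have hsgn : ∀ a ∈ A, ∀ b : Sph (m+1), b ∈ Bp → 0 ≤ inner ℝ (a : EuclideanSpace ℝ (Fin (m+1+1))) (b : EuclideanSpace ℝ (Fin (m+1+1))) := by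
    intro a ha b hb
    have h1 := htri r (Real.pi / 2 - r) a p b hr0.le (by linarith) (by linarith) (by linarith) ha
      (by rw [Real.cos_pi_div_two_sub, real_inner_comm]; exact hb)
    rw [← Real.arccos_le_pi_div_two]
    linarith
  have hsgn' : ∀ a ∈ A, ∀ b : Sph (m+1), b ∈ Bn → inner ℝ (a : EuclideanSpace ℝ (Fin (m+1+1))) (b : EuclideanSpace ℝ (Fin (m+1+1))) ≤ 0 := by
    intro a ha b hb
    have h1 := hsgn a ha (-b) (by
      have hb' : inner ℝ (b : EuclideanSpace ℝ (Fin (m+1+1))) (p : EuclideanSpace ℝ (Fin (m+1+1))) ≤ - Real.sin r := hb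
      change Real.sin r ≤ inner ℝ (-(b : EuclideanSpace ℝ (Fin (m+1+1)))) (p : EuclideanSpace ℝ (Fin (m+1+1)))
      rw [inner_neg_left]; linarith)
    have h2 : 0 ≤ inner ℝ (a : EuclideanSpace ℝ (Fin (m+1+1))) (-(b : EuclideanSpace ℝ (Fin (m+1+1)))) := h1
    rw [inner_neg_right] at h2
    linarith
  rw [Nat.add_sub_cancel]
  set β := capMeasure m (Real.pi / 2 - 2 * θ)
  set N := {u : Sph (m+1) | |inner ℝ (u : EuclideanSpace ℝ (Fin (m+2))) (p : EuclideanSpace ℝ (Fin (m+2)))| < Real.sin r}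
  have hcover : 1 ≤ μ2 Bp + μ2 Bn + μ2 N := by
    rw [← hμ2p.measure_univ]
    have : (univ : Set (Sph (m+1))) ⊆ (Bp ∪ Bn) ∪ N := by
      intro u _
      by_cases h : |inner ℝ (u : EuclideanSpace ℝ (Fin (m+2))) (p : EuclideanSpace ℝ (Fin (m+2)))| < Real.sin r
      · exact Or.inr h
      · left
        rcases le_abs'.1 (not_lt.1 h) with h | h
        · exact Or.inr h
        · exact Or.inl h
    exact (measure_mono this).trans ((measure_union_le _ _).trans (add_le_add_left (measure_union_le _ _) _))
  have h2β : 2 * β ≤ μ2 Bp + μ2 Bn :=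
    (ENNReal.add_le_add_iff_right (measure_ne_top μ2 N)).1 (hband.trans hcover)
  rcases le_total β (μ2 Bp) with h | h
  · exact ⟨A, Bp, hA, h, Or.inl hsgn⟩
  · refine ⟨A, Bn, hA, ?_, Or.inr hsgn'⟩
    rw [two_mul] at h2β
    have hfin : μ2 Bp ≠ ∞ := measure_ne_top _ _
    have : μ2 Bp + β ≤ μ2 Bp + μ2 Bn := le_trans (add_le_add_left h β) h2β
    exact (ENNReal.add_le_add_iff_left hfin).1 this
end
end
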